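/- arXiv:1810.03112 — 2 statements merged into one kernel-verified Lean document; each statement's English description precedes it below -/
import Mathlib

section
/- Let z ∈ ℂ with Im z ≠ 0. Suppose u : [x₁(z),∞) → ℂ is bounded, u and p·u' are locally absolutely continuous, (p(x)u'(x))' − 2ω(x,z)p(x)u'(x) = r(x,z)u(x) for almost every x ≥ x₁(z), and u(x) → 1 as x → ∞. Then u satisfies the Volterra integral equation u(x) = 1 + ∫ₓ^∞ G(x,y,z) r(y,z) u(y) dy for every x ≥ x₁(z). -/
open MeasureTheory Filter Set Complex

noncomputable section

/-- The principal-branch square root `ω(x,z) = ((q x − z)/p x)^{1/2}`. -/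
def omg (p q : ℝ → ℝ) (z : ℂ) (x : ℝ) : ℂ :=
  (((q x : ℂ) - z) / (p x : ℂ)) ^ (1 / 2 : ℂ)

/-- `Ω(x,z) = ∫₀ˣ ω(y,z) dy`. -/
def Omg (p q : ℝ → ℝ) (z : ℂ) (x : ℝ) : ℂ :=
  ∫ y in (0:ℝ)..x, omg p q z y

/-- `a(x,z) = exp(−Ω(x,z))`. -/
def aa (p q : ℝ → ℝ) (z : ℂ) (x : ℝ) : ℂ :=
  Complex.exp (-(Omg p q z x))

/-- Assumption (PQ): `p > 0` on `[0,∞)`, locally absolutely continuous with integrable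
derivative `p'` and limit `p₀ > 0` at `+∞`; `q` integrable on `(0,x₀)`, locally absolutely
continuous on `[x₀,∞)` with integrable derivative `q'` there, and `q → 0` at `+∞`.
Absolute continuity is encoded by the fundamental theorem of calculus representation. -/
structure PQData (p p' q q' : ℝ → ℝ) (p₀ x₀ : ℝ) : Prop where
  p_pos : ∀ x : ℝ, 0 ≤ x → 0 < p x
  hp₀ : 0 < p₀
  hx₀ : 0 ≤ x₀
  p_ac : ∀ x : ℝ, 0 ≤ x → p x = p 0 + ∫ t in (0:ℝ)..x, p' t
  p'_int : IntegrableOn p' (Ioi (0:ℝ))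
  p_lim : Tendsto p atTop (nhds p₀)
  q_int : IntegrableOn q (Ioo (0:ℝ) x₀)
  q_ac : ∀ x : ℝ, x₀ ≤ x → q x = q x₀ + ∫ t in x₀..x, q' t
  q'_int : IntegrableOn q' (Ioi x₀)
  q_lim : Tendsto q atTop (nhds (0:ℝ))

/-- `f` (with derivative `f'`) solves `−(p f')' + q f = z f` on `I`:
`f` is differentiable on `I` with derivative `f'`, and `p·f'` is locally absolutely
continuous on `I` with a.e. derivative `(q − z)·f` (encoded via the FTC representation). -/
def IsSol (p q : ℝ → ℝ) (z : ℂ) (I : Set ℝ) (f f' : ℝ → ℂ) : Prop :=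
  (∀ x ∈ I, HasDerivWithinAt f (f' x) I x) ∧
    ∀ x ∈ I, ∀ y ∈ I,
      (p y : ℂ) * f' y - (p x : ℂ) * f' x = ∫ t in x..y, ((q t : ℂ) - z) * f t

/-- `ε(x) = ∫ₓ^∞ (|p'| + |q'|)`. -/
def eps (p' q' : ℝ → ℝ) (x : ℝ) : ℝ :=
  ∫ y in Ioi x, (|p' y| + |q' y|)

/-- The Volterra kernel `G(x,y,z) = a(y,z)² ∫ₓ^y p(s)⁻¹ a(s,z)⁻² ds`. -/
def Gker (p q : ℝ → ℝ) (z : ℂ) (x y : ℝ) : ℂ :=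
  aa p q z y ^ 2 * ∫ s in x..y, ((p s : ℂ))⁻¹ * (aa p q z s ^ 2)⁻¹

/-- `Φ(x,λ) = ∫₀ˣ √(max((λ − q)/p, 0))`. -/
def Phi (p q : ℝ → ℝ) (lam x : ℝ) : ℝ :=
  ∫ y in (0:ℝ)..x, Real.sqrt (max ((lam - q y) / p y) 0)

/-- `K(λ) = exp(−∫₀^∞ √(max((q − λ)/p, 0)))`. -/
def Kc (p q : ℝ → ℝ) (lam : ℝ) : ℝ :=
  Real.exp (-∫ y in Ioi (0:ℝ), Real.sqrt (max ((q y - lam) / p y) 0))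

/-- `ξ(x) = θ(x)·∫_ϱ^x θ(y)⁻² p(y)⁻¹ dy`. -/
def xiFun (p : ℝ → ℝ) (θ : ℝ → ℂ) (ϱ x : ℝ) : ℂ :=
  θ x * ∫ y in ϱ..x, (θ y ^ 2)⁻¹ * ((p y : ℂ))⁻¹

/-- The derivative of `ξ`: `ξ'(x) = θ'(x)·∫_ϱ^x θ⁻² p⁻¹ + θ(x)⁻¹ p(x)⁻¹`. -/
def xiFun' (p : ℝ → ℝ) (θ θ' : ℝ → ℂ) (ϱ x : ℝ) : ℂ :=
  θ' x * (∫ y in ϱ..x, (θ y ^ 2)⁻¹ * ((p y : ℂ))⁻¹) + (θ x)⁻¹ * ((p x : ℂ))⁻¹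

open scoped Topology

lemma ac_of_dist_le {X Y : Type*} [PseudoMetricSpace X] [PseudoMetricSpace Y]
    {f : ℝ → X} {g : ℝ → Y} {a b : ℝ}
    (hg : AbsolutelyContinuousOnInterval g a b) (C : ℝ)
    (h : ∀ x ∈ uIcc a b, ∀ y ∈ uIcc a b, dist (f x) (f y) ≤ C * dist (g x) (g y)) :
    AbsolutelyContinuousOnInterval f a b := by
  unfold AbsolutelyContinuousOnInterval at *
  have h2 := hg.const_mul C
  rw [mul_zero] at h2
  refine squeeze_zero' (Eventually.of_forall fun E => Finset.sum_nonneg fun _ _ => dist_nonneg) ?_ h2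
  rw [eventually_inf_principal]
  refine Eventually.of_forall fun E hE => ?_
  rw [Finset.mul_sum]
  exact Finset.sum_le_sum fun i hi => h _ (hE.1 i hi).1 _ (hE.1 i hi).2

lemma ac_congr {X : Type*} [PseudoMetricSpace X] {f g : ℝ → X} {a b : ℝ}
    (hg : AbsolutelyContinuousOnInterval g a b) (h : ∀ x ∈ uIcc a b, f x = g x) :
    AbsolutelyContinuousOnInterval f a b :=
  ac_of_dist_le hg 1 fun x hx y hy => by rw [h x hx, h y hy, one_mul]

lemma ac_const {X : Type*} [PseudoMetricSpace X] (c : X) (a b : ℝ) :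
    AbsolutelyContinuousOnInterval (fun _ : ℝ => c) a b := by
  simpa [AbsolutelyContinuousOnInterval] using tendsto_const_nhds

lemma ac_ofReal {f : ℝ → ℝ} {a b : ℝ} (hf : AbsolutelyContinuousOnInterval f a b) :
    AbsolutelyContinuousOnInterval (fun x => (f x : ℂ)) a b :=
  ac_of_dist_le hf 1 fun x _ y _ => by
    rw [one_mul, dist_eq_norm, ← Complex.ofReal_sub, Complex.norm_real, dist_eq_norm]

lemma ac_re {f : ℝ → ℂ} {a b : ℝ} (hf : AbsolutelyContinuousOnInterval f a b) :
    AbsolutelyContinuousOnInterval (fun x => (f x).re) a b :=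
  ac_of_dist_le hf 1 fun x _ y _ => by
    rw [one_mul, dist_eq_norm, dist_eq_norm, ← Complex.sub_re]
    exact Complex.abs_re_le_norm _

lemma ac_im {f : ℝ → ℂ} {a b : ℝ} (hf : AbsolutelyContinuousOnInterval f a b) :
    AbsolutelyContinuousOnInterval (fun x => (f x).im) a b :=
  ac_of_dist_le hf 1 fun x _ y _ => by
    rw [one_mul, dist_eq_norm, dist_eq_norm, ← Complex.sub_im]
    exact Complex.abs_im_le_norm _

lemma ac_mul {f g : ℝ → ℂ} {a b : ℝ} (hf : AbsolutelyContinuousOnInterval f a b)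
    (hg : AbsolutelyContinuousOnInterval g a b) :
    AbsolutelyContinuousOnInterval (fun x => f x * g x) a b :=
  hf.smul hg

lemma ii_re {f : ℝ → ℂ} {a b : ℝ} (hf : IntervalIntegrable f volume a b) :
    IntervalIntegrable (fun x => (f x).re) volume a b :=
  ⟨Complex.reCLM.integrable_comp hf.1, Complex.reCLM.integrable_comp hf.2⟩

lemma ii_im {f : ℝ → ℂ} {a b : ℝ} (hf : IntervalIntegrable f volume a b) :
    IntervalIntegrable (fun x => (f x).im) volume a b :=
  ⟨Complex.imCLM.integrable_comp hf.1, Complex.imCLM.integrable_comp hf.2⟩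

lemma ii_ofReal {f : ℝ → ℝ} {a b : ℝ} (hf : IntervalIntegrable f volume a b) :
    IntervalIntegrable (fun x => (f x : ℂ)) volume a b :=
  ⟨hf.1.ofReal, hf.2.ofReal⟩

lemma ii_split {f : ℝ → ℂ} {a b : ℝ} (hf : IntervalIntegrable f volume a b) :
    ∫ t in a..b, f t = ((∫ t in a..b, (f t).re : ℝ) : ℂ) + ((∫ t in a..b, (f t).im : ℝ) : ℂ) * I := by
  rw [← intervalIntegral.integral_ofReal, ← intervalIntegral.integral_ofReal,
    ← intervalIntegral.integral_mul_const, ← intervalIntegral.integral_add]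
  · simp [Complex.re_add_im]
  · exact ii_ofReal (ii_re hf)
  · exact (ii_ofReal (ii_im hf)).mul_const _

lemma ac_integral {f : ℝ → ℂ} {a b : ℝ} (hf : IntervalIntegrable f volume a b) :
    AbsolutelyContinuousOnInterval (fun x => ∫ t in a..x, f t) a b := by
  have h1 := ac_ofReal
    ((ii_re hf).absolutelyContinuousOnInterval_intervalIntegral (c := a) left_mem_uIcc)
  have h2 := ac_ofReal
    ((ii_im hf).absolutelyContinuousOnInterval_intervalIntegral (c := a) left_mem_uIcc)
  refine ac_congr (h1.add (ac_mul h2 (ac_const I a b))) fun x hx => ?_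
  exact ii_split (hf.mono_set (uIcc_subset_uIcc left_mem_uIcc hx))

lemma ac_ftc {f f' : ℝ → ℂ} {a b : ℝ} (hf : AbsolutelyContinuousOnInterval f a b)
    (hd : ∀ᵐ x, x ∈ uIcc a b → HasDerivAt f (f' x) x) :
    IntervalIntegrable f' volume a b ∧ ∫ t in a..b, f' t = f b - f a := by
  have hre := ac_re hf
  have him := ac_im hf
  have e1 : ∀ᵐ x, x ∈ uIoc a b → deriv (fun x => (f x).re) x = (f' x).re := by
    filter_upwards [hd] with x hx hx2
    exact ((Complex.reCLM.hasFDerivAt.comp_hasDerivAt x (hx (uIoc_subset_uIcc hx2)))).deriv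
  have e2 : ∀ᵐ x, x ∈ uIoc a b → deriv (fun x => (f x).im) x = (f' x).im := by
    filter_upwards [hd] with x hx hx2
    exact ((Complex.imCLM.hasFDerivAt.comp_hasDerivAt x (hx (uIoc_subset_uIcc hx2)))).deriv
  have i1 : IntervalIntegrable (fun x => (f' x).re) volume a b :=
    hre.intervalIntegrable_deriv.congr_ae ((ae_restrict_iff' measurableSet_uIoc).2 e1)
  have i2 : IntervalIntegrable (fun x => (f' x).im) volume a b :=
    him.intervalIntegrable_deriv.congr_ae ((ae_restrict_iff' measurableSet_uIoc).2 e2)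
  have i : IntervalIntegrable f' volume a b := by
    have := (ii_ofReal i1).add ((ii_ofReal i2).mul_const I)
    simpa [Complex.re_add_im] using this
  refine ⟨i, ?_⟩
  rw [ii_split i, ← intervalIntegral.integral_congr_ae e1, ← intervalIntegral.integral_congr_ae e2,
    hre.integral_deriv_eq_sub, him.integral_deriv_eq_sub]
  apply Complex.ext <;> simp

lemma ac_of_C1 {f f' : ℝ → ℂ} {a b : ℝ} (hab : a ≤ b)
    (hd : ∀ x ∈ Icc a b, HasDerivWithinAt f (f' x) (Icc a b) x) (hc : ContinuousOn f' (Icc a b)) :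
    AbsolutelyContinuousOnInterval f a b := by
  obtain ⟨C, hC⟩ := isCompact_Icc.exists_bound_of_continuousOn hc
  have hCnn : ∀ x ∈ Icc a b, ‖f' x‖₊ ≤ C.toNNReal := fun x hx => by
    rw [← NNReal.coe_le_coe, coe_nnnorm]
    exact (hC x hx).trans (Real.le_coe_toNNReal C)
  apply LipschitzOnWith.absolutelyContinuousOnInterval (K := C.toNNReal)
  rw [uIcc_of_le hab]
  exact (convex_Icc a b).lipschitzOnWith_of_nnnorm_hasDerivWithin_le hd hCnn


lemma ae_deriv_of_rep {f g : ℝ → ℂ} {a : ℝ}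
    (hi : ∀ b, a ≤ b → IntervalIntegrable g volume a b)
    (hf : ∀ x, a ≤ x → f x = f a + ∫ t in a..x, g t) :
    ∀ᵐ x, a ≤ x → HasDerivAt f (g x) x := by
  have h : ∀ n : ℕ, ∀ᵐ x, x ∈ uIcc a (a + n) → ∀ c ∈ uIcc a (a + n),
      HasDerivAt (fun x => ∫ t in c..x, g t) (g x) x := fun n =>
    (hi (a + n) (by simp)).ae_hasDerivAt_integral
  have hne : ∀ᵐ x : ℝ, x ≠ a := by simp [ae_iff, measure_singleton]
  filter_upwards [ae_all_iff.2 h, hne] with x hx hxa hax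
  obtain ⟨n, hn⟩ := exists_nat_ge (x - a)
  have hlt : a < x := lt_of_le_of_ne hax (Ne.symm hxa)
  have h1 := hx n (by rw [uIcc_of_le (by simp)]; exact ⟨hax, by linarith⟩) a left_mem_uIcc
  have h2 := h1.const_add (f a)
  refine h2.congr_of_eventuallyEq ?_
  filter_upwards [lt_mem_nhds hlt] with y hy
  exact hf y hy.le

lemma cont_of_ac {X : Type*} [NormedAddCommGroup X] {f : ℝ → X} {a : ℝ}
    (h : ∀ b, a ≤ b → AbsolutelyContinuousOnInterval f a b) : ContinuousOn f (Ici a) := by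
  intro x hx
  have hx' : a ≤ x := hx
  have hlt : x < x + 1 := by linarith
  have h1 := (h (x + 1) (hx'.trans hlt.le)).continuousOn
  rw [uIcc_of_le (hx'.trans hlt.le)] at h1
  refine (h1 x ⟨hx', hlt.le⟩).mono_of_mem_nhdsWithin ?_
  rw [← Ici_inter_Iic]
  exact inter_mem self_mem_nhdsWithin (mem_nhdsWithin_of_mem_nhds (Iic_mem_nhds hlt))

lemma ii_of_Ioi {E : Type*} [NormedAddCommGroup E] {g : ℝ → E} {a b : ℝ}
    (h : IntegrableOn g (Ioi a)) (hab : a ≤ b) :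
    IntervalIntegrable g volume a b :=
  (intervalIntegrable_iff_integrableOn_Ioc_of_le hab).2 (h.mono_set Ioc_subset_Ioi_self)

lemma ac_of_rep {f g : ℝ → ℝ} {a : ℝ} (h : IntegrableOn g (Ioi a))
    (hf : ∀ x, a ≤ x → f x = f a + ∫ t in a..x, g t) (b : ℝ) (hab : a ≤ b) :
    AbsolutelyContinuousOnInterval f a b := by
  refine ac_congr ((ac_const (f a) a b).add
    ((ii_of_Ioi h hab).absolutelyContinuousOnInterval_intervalIntegral (c := a) left_mem_uIcc)) ?_
  intro x hx
  rw [uIcc_of_le hab] at hx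
  exact hf x hx.1

lemma bdd_of_tendsto {E : Type*} [NormedAddCommGroup E] {f : ℝ → E} {a : ℝ} {l : E}
    (hc : ContinuousOn f (Ici a))
    (hl : Tendsto f atTop (𝓝 l)) : ∃ C, 0 < C ∧ ∀ x, a ≤ x → ‖f x‖ ≤ C := by
  have h1 : ∀ᶠ x in atTop, ‖f x‖ < ‖l‖ + 1 := hl.norm.eventually_lt_const (by linarith)
  obtain ⟨N, hN⟩ := eventually_atTop.1 h1
  obtain ⟨C, hC⟩ := (isCompact_Icc (a := a) (b := N)).exists_bound_of_continuousOn
    (hc.mono Icc_subset_Ici_self)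
  refine ⟨max C (‖l‖ + 1), lt_max_of_lt_right (by positivity), fun x hx => ?_⟩
  rcases le_total x N with h | h
  · exact (hC x ⟨hx, h⟩).trans (le_max_left _ _)
  · exact (hN x h).le.trans (le_max_right _ _)

lemma v_int {w v α β : ℝ → ℂ} {a : ℝ}
    (hw : ∀ x ∈ Ici a, ∀ y ∈ Ici a, w y - w x = ∫ t in x..y, v t)
    (hode : ∀ᵐ x, a ≤ x → v x = α x * w x + β x)
    (hα : ContinuousOn α (Ici a))
    (hβ : ∀ b, a ≤ b → IntegrableOn β (Icc a b)) :
    ∀ b, a ≤ b → IntegrableOn v (Icc a b) := by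
  -- if `w` is constant on `[c,d]` then `v` is integrable there
  have key : ∀ c d, a ≤ c → c ≤ d → ∀ k : ℂ, (∀ x ∈ Icc c d, w x = k) → IntegrableOn v (Icc c d) := by
    intro c d hac hcd k hk
    have h1 : IntegrableOn (fun x => α x * k + β x) (Icc c d) := by
      refine Integrable.add ?_ ((hβ d (hac.trans hcd)).mono_set (Icc_subset_Icc_left hac))
      exact ContinuousOn.integrableOn_Icc
        ((hα.mono (fun x hx => hac.trans hx.1)).mul continuousOn_const)
    refine h1.congr_fun_ae ?_
    rw [EventuallyEq, ae_restrict_iff' measurableSet_Icc]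
    filter_upwards [hode] with x hx hxm
    rw [hx (hac.trans hxm.1), hk x hxm]
  have key2 : ∀ c d, a ≤ c → c ≤ d → ¬ IntegrableOn v (Icc c d) → w d = w c := by
    intro c d hac hcd hn
    have h := hw c hac d (hac.trans hcd)
    rw [intervalIntegral.integral_undef, sub_eq_zero] at h
    · exact h
    · rw [intervalIntegrable_iff_integrableOn_Icc_of_le hcd]
      exact hn
  have hloc : LocallyIntegrableOn v (Ici a) := by
    intro c hc
    have hac : a ≤ c := hc
    have hset : Ici a ⊆ Icc a c ∪ Ici c := fun x hx => by
      rcases le_total x c with h | h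
      · exact Or.inl ⟨hx, h⟩
      · exact Or.inr h
    refine IntegrableAtFilter.filter_mono (nhdsWithin_mono c hset) ?_
    rw [nhdsWithin_union, IntegrableAtFilter.sup_iff]
    constructor
    · by_contra hcon
      apply hcon
      refine ⟨Icc a c, self_mem_nhdsWithin, key a c le_rfl hac (w c) ?_⟩
      intro x hx
      rcases eq_or_lt_of_le hx.2 with h | h
      · rw [h]
      refine (key2 x c hx.1 hx.2 fun hI => hcon ⟨Icc x c, ?_, hI⟩).symm
      rw [mem_nhdsWithin]
      exact ⟨Ioi x, isOpen_Ioi, h, fun y hy => ⟨le_of_lt hy.1, hy.2.2⟩⟩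
    · by_contra hcon
      apply hcon
      refine ⟨Icc c (c + 1), Icc_mem_nhdsGE (by linarith), key c (c + 1) hac (by linarith) (w c) ?_⟩
      intro x hx
      rcases eq_or_lt_of_le hx.1 with h | h
      · rw [h]
      exact key2 c x hac hx.1 fun hI => hcon ⟨Icc c x, Icc_mem_nhdsGE h, hI⟩
  intro b _
  exact hloc.integrableOn_compact_subset Icc_subset_Ici_self isCompact_Icc

/-- If `u` converges and `u'` converges then `u' → 0`. -/
lemma deriv_lim_zero {u u' : ℝ → ℂ} {a : ℝ} {l V : ℂ}
    (hu : ∀ x ∈ Ici a, HasDerivWithinAt u (u' x) (Ici a) x)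
    (h1 : Tendsto u atTop (𝓝 l)) (h2 : Tendsto u' atTop (𝓝 V)) : V = 0 := by
  have h3 : Tendsto (fun x => u (x + 1) - u x) atTop (𝓝 (l - l)) :=
    (h1.comp (tendsto_atTop_add_const_right _ 1 tendsto_id)).sub h1
  have h4 : Tendsto (fun x => u (x + 1) - u x) atTop (𝓝 V) := by
    rw [Metric.tendsto_atTop]
    intro ε hε
    obtain ⟨N, hN⟩ := Metric.tendsto_atTop.1 h2 (ε / 2) (by positivity)
    refine ⟨max N a, fun x hx => ?_⟩
    have hxN : N ≤ x := (le_max_left _ _).trans hx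
    have hxa : a ≤ x := (le_max_right _ _).trans hx
    have hd : ∀ y ∈ Icc x (x + 1),
        HasDerivWithinAt (fun y : ℝ => u y - (y : ℂ) * V) (u' y - 1 * V) (Icc x (x + 1)) y := by
      intro y hy
      refine ((hu y (hxa.trans hy.1)).mono fun t ht => hxa.trans ht.1).sub ?_
      exact ((Complex.ofRealCLM.hasDerivAt (x := y)).mul_const V).hasDerivWithinAt
    have hb : ∀ y ∈ Icc x (x + 1), ‖u' y - 1 * V‖ ≤ ε / 2 := by
      intro y hy
      rw [one_mul, ← dist_eq_norm]
      exact (hN y (hxN.trans hy.1)).le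
    have := Convex.norm_image_sub_le_of_norm_hasDerivWithin_le hd hb (convex_Icc x (x + 1))
      (left_mem_Icc.2 (by linarith)) (right_mem_Icc.2 (by linarith))
    rw [dist_eq_norm]
    have e : u (x + 1) - (((x + 1 : ℝ) : ℂ)) * V - (u x - (x : ℂ) * V) = u (x + 1) - u x - V := by
      push_cast; ring
    rw [e] at this
    simp at this
    linarith
  rw [tendsto_nhds_unique h4 h3, sub_self]

lemma hasDerivWithinAt_integral_Ici {f : ℝ → ℂ} {a : ℝ} (hf : ContinuousOn f (Ici a)) :
    ∀ x ∈ Ici a, HasDerivWithinAt (fun x => ∫ t in a..x, f t) (f x) (Ici a) x := by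
  have hc : Continuous (fun x => f (max x a)) :=
    hf.comp_continuous (by fun_prop) (fun x => le_max_right x a)
  have heq : ∀ x ∈ Ici a, ∫ t in a..x, f t = ∫ t in a..x, f (max t a) := by
    intro x hx
    apply intervalIntegral.integral_congr
    intro t ht
    rw [uIcc_of_le hx] at ht
    simp only [max_eq_left ht.1]
  intro x hx
  have h := (intervalIntegral.integral_hasDerivAt_right (hc.intervalIntegrable a x)
    hc.stronglyMeasurable.stronglyMeasurableAtFilter hc.continuousAt).hasDerivWithinAt (s := Ici a)
  have hx' : max x a = x := max_eq_left hx
  rw [hx'] at h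
  exact h.congr heq (heq x hx)

lemma omg_sq (p q : ℝ → ℝ) (z : ℂ) (x : ℝ) :
    omg p q z x ^ 2 = ((q x : ℂ) - z) / (p x : ℂ) := by
  unfold omg
  rw [one_div]
  exact_mod_cast Complex.cpow_nat_inv_pow _ two_ne_zero

lemma omg_re (p q : ℝ → ℝ) (z : ℂ) (x : ℝ) : 0 ≤ (omg p q z x).re := by
  unfold omg
  rw [one_div, Complex.cpow_inv_two_re]
  positivity

lemma m_sq {p : ℝ → ℝ} (q : ℝ → ℝ) (z : ℂ) {x : ℝ} (hp : 0 < p x) :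
    ((p x : ℂ) * omg p q z x) * ((p x : ℂ) * omg p q z x) = (p x : ℂ) * ((q x : ℂ) - z) := by
  have h : (p x : ℂ) ≠ 0 := by exact_mod_cast hp.ne'
  have := omg_sq p q z x
  calc _ = (p x : ℂ) ^ 2 * omg p q z x ^ 2 := by ring
    _ = _ := by rw [this]; field_simp

lemma m_lower {p q : ℝ → ℝ} {z : ℂ} (hz : z.im ≠ 0) {x₁ pl pu : ℝ} (hpl : 0 < pl)
    (h : ∀ x, x₁ ≤ x → pl ≤ p x ∧ p x ≤ pu) (hq : ∀ x : ℝ, x₁ ≤ x → |q x| ≤ ‖z‖ / 2) :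
    ∃ δ : ℝ, 0 < δ ∧ ∀ x, x₁ ≤ x → δ ≤ ((p x : ℂ) * omg p q z x).re := by
  have hpu : 0 < pu := hpl.trans_le ((h x₁ le_rfl).1.trans (h x₁ le_rfl).2)
  set M : ℝ := 1 + pu * (2 * ‖z‖) with hM
  have hM0 : 0 < M := by positivity
  have hzi : 0 < |z.im| := abs_pos.2 hz
  refine ⟨pl * |z.im| / (2 * M), by positivity, fun x hx => ?_⟩
  have hpx : 0 < p x := hpl.trans_le (h x hx).1
  have hsq := m_sq q z hpx
  set m : ℂ := (p x : ℂ) * omg p q z x with hm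
  have hre : 0 ≤ m.re := by
    rw [hm, Complex.re_ofReal_mul]
    exact mul_nonneg hpx.le (omg_re p q z x)
  have hn : ‖m‖ * ‖m‖ ≤ pu * (2 * ‖z‖) := by
    rw [← norm_mul, hsq, norm_mul, Complex.norm_real, Real.norm_of_nonneg hpx.le]
    refine mul_le_mul (h x hx).2 ?_ (norm_nonneg _) hpu.le
    refine (norm_sub_le _ _).trans ?_
    rw [Complex.norm_real, Real.norm_eq_abs]
    linarith [hq x hx, norm_nonneg z]
  have hmM : ‖m‖ ≤ M := by nlinarith [norm_nonneg m]
  have him := congrArg Complex.im hsq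
  simp at him
  have h1 : 2 * (m.re * |m.im|) = p x * |z.im| := by
    have : |2 * (m.re * m.im)| = |p x * z.im| := by
      rw [← abs_neg (p x * z.im), ← him]; congr 1; ring
    rwa [abs_mul, abs_mul, abs_mul, abs_of_pos hpx, abs_of_nonneg hre,
      abs_of_pos (two_pos : (0:ℝ) < 2)] at this
  have h2 : |m.im| ≤ M := (Complex.abs_im_le_norm m).trans hmM
  rw [div_le_iff₀ (by positivity)]
  have h3 : pl * |z.im| ≤ p x * |z.im| := mul_le_mul_of_nonneg_right (h x hx).1 hzi.le
  have h4 : m.re * |m.im| ≤ m.re * M := mul_le_mul_of_nonneg_left h2 hre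
  linarith

lemma p_bounds {p p' q q' : ℝ → ℝ} {p₀ x₀ : ℝ} (hPQ : PQData p p' q q' p₀ x₀) :
    ∃ pl pu : ℝ, 0 < pl ∧ ∀ x, 0 ≤ x → pl ≤ p x ∧ p x ≤ pu := by
  have hc : ContinuousOn p (Ici 0) := cont_of_ac (ac_of_rep hPQ.p'_int hPQ.p_ac)
  obtain ⟨C, hC0, hC⟩ := bdd_of_tendsto hc hPQ.p_lim
  obtain ⟨D, hD0, hD⟩ := bdd_of_tendsto (hc.inv₀ fun x hx => (hPQ.p_pos x hx).ne')
    (hPQ.p_lim.inv₀ hPQ.hp₀.ne')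
  refine ⟨D⁻¹, C, inv_pos.2 hD0, fun x hx => ⟨?_, (Real.le_norm_self _).trans (hC x hx)⟩⟩
  have := (Real.le_norm_self _).trans (hD x hx)
  exact inv_le_of_inv_le₀ (hPQ.p_pos x hx) this

lemma m_ac {p p' q q' : ℝ → ℝ} {p₀ x₀ : ℝ} (hPQ : PQData p p' q q' p₀ x₀) {z : ℂ}
    {x₁ δ : ℝ} (hx₁ : x₀ ≤ x₁) (hδ : 0 < δ)
    (h : ∀ x, x₁ ≤ x → δ ≤ ((p x : ℂ) * omg p q z x).re) (b : ℝ) (hb : x₁ ≤ b) :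
    AbsolutelyContinuousOnInterval (fun x => (p x : ℂ) * omg p q z x) x₁ b := by
  have hx0 : 0 ≤ x₁ := hPQ.hx₀.trans hx₁
  have hp := (ac_of_rep hPQ.p'_int hPQ.p_ac b (hx0.trans hb)).mono (c := x₁) (d := b) (by
    rw [uIcc_of_le hb, uIcc_of_le (hx0.trans hb)]; exact Icc_subset_Icc_left hx0)
  have hq := (ac_of_rep hPQ.q'_int hPQ.q_ac b (hx₁.trans hb)).mono (c := x₁) (d := b) (by
    rw [uIcc_of_le hb, uIcc_of_le (hx₁.trans hb)]; exact Icc_subset_Icc_left hx₁)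
  have hP := ac_mul (ac_ofReal hp) ((ac_ofReal hq).sub (ac_const z x₁ b))
  refine ac_of_dist_le hP (1 / (2 * δ)) fun x hx y hy => ?_
  rw [uIcc_of_le hb] at hx hy
  have e1 := m_sq q z (hPQ.p_pos x (hx0.trans hx.1))
  have e2 := m_sq q z (hPQ.p_pos y (hx0.trans hy.1))
  have d1 := h x hx.1
  have d2 := h y hy.1
  simp only [Pi.sub_apply]
  rw [← e1, ← e2]
  set m1 : ℂ := (p x : ℂ) * omg p q z x
  set m2 : ℂ := (p y : ℂ) * omg p q z y
  rw [dist_eq_norm, dist_eq_norm, show m1 * m1 - m2 * m2 = (m1 + m2) * (m1 - m2) by ring, norm_mul]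
  have h3 : 2 * δ ≤ ‖m1 + m2‖ := by
    refine le_trans ?_ (Complex.re_le_norm _)
    rw [Complex.add_re]; linarith
  rw [one_div, inv_mul_eq_div, le_div_iff₀ (by positivity), mul_comm]
  exact mul_le_mul_of_nonneg_right h3 (norm_nonneg _)

lemma bdd_cont_integrable {f g : ℝ → ℂ} {a C : ℝ} (hg : IntegrableOn g (Ioi a))
    (hf : ContinuousOn f (Ici a)) (hC : ∀ x, a ≤ x → ‖f x‖ ≤ C) :
    IntegrableOn (fun x => f x * g x) (Ioi a) := by
  refine Integrable.bdd_mul (c := C) hg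
    ((hf.mono Ioi_subset_Ici_self).aestronglyMeasurable measurableSet_Ioi) ?_
  rw [ae_restrict_iff' measurableSet_Ioi]
  exact Eventually.of_forall fun x hx => hC x (le_of_lt hx)

lemma r_int {p p' q q' : ℝ → ℝ} {p₀ x₀ : ℝ} (hPQ : PQData p p' q q' p₀ x₀) {z : ℂ}
    {x₁ δ pl pu : ℝ} (hx₁ : x₀ ≤ x₁) (hδ : 0 < δ) (hpl : 0 < pl)
    (hpb : ∀ x, 0 ≤ x → pl ≤ p x ∧ p x ≤ pu)
    (hq : ∀ x : ℝ, x₁ ≤ x → |q x| ≤ ‖z‖ / 2)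
    (h : ∀ x, x₁ ≤ x → δ ≤ ((p x : ℂ) * omg p q z x).re)
    {r : ℝ → ℂ}
    (hr : ∀ᵐ x ∂(volume : Measure ℝ), x₁ ≤ x →
      HasDerivAt (fun t => (p t : ℂ) * omg p q z t) (r x) x) : IntegrableOn r (Ioi x₁) := by
  have hx0 : 0 ≤ x₁ := hPQ.hx₀.trans hx₁
  have hpc : ContinuousOn p (Ici x₁) :=
    (cont_of_ac (ac_of_rep hPQ.p'_int hPQ.p_ac)).mono (Ici_subset_Ici.2 hx0)
  have hqc : ContinuousOn q (Ici x₁) :=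
    (cont_of_ac (ac_of_rep hPQ.q'_int hPQ.q_ac)).mono (Ici_subset_Ici.2 hx₁)
  have hmc := cont_of_ac (m_ac hPQ hx₁ hδ h)
  set m : ℝ → ℂ := fun x => (p x : ℂ) * omg p q z x with hm
  have hmn : ∀ x, x₁ ≤ x → δ ≤ ‖m x‖ := fun x hx => (h x hx).trans (Complex.re_le_norm _)
  have hm0 : ∀ x, x₁ ≤ x → 2 * m x ≠ 0 := fun x hx =>
    mul_ne_zero two_ne_zero (norm_pos_iff.1 (hδ.trans_le (hmn x hx)))
  have hm2 : ∀ x, x₁ ≤ x → 2 * δ ≤ ‖2 * m x‖ := fun x hx => by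
    rw [norm_mul]; simpa using hmn x hx
  have i1 : IntegrableOn (fun x => ((q x : ℂ) - z) / (2 * m x) * (p' x : ℂ)) (Ioi x₁) := by
    refine bdd_cont_integrable (C := 2 * ‖z‖ / (2 * δ)) ?_ ?_ ?_
    · exact (hPQ.p'_int.mono_set (Ioi_subset_Ioi hx0)).ofReal
    · exact ContinuousOn.div ((Complex.continuous_ofReal.comp_continuousOn hqc).sub
        continuousOn_const) (continuousOn_const.mul hmc) hm0
    · intro x hx
      rw [norm_div]
      refine div_le_div₀ (by positivity) ?_ (by positivity) (hm2 x hx)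
      refine (norm_sub_le _ _).trans ?_
      rw [Complex.norm_real, Real.norm_eq_abs]
      linarith [hq x hx, norm_nonneg z]
  have i2 : IntegrableOn (fun x => (p x : ℂ) / (2 * m x) * (q' x : ℂ)) (Ioi x₁) := by
    refine bdd_cont_integrable (C := pu / (2 * δ)) ?_ ?_ ?_
    · exact (hPQ.q'_int.mono_set (Ioi_subset_Ioi hx₁)).ofReal
    · exact ContinuousOn.div (Complex.continuous_ofReal.comp_continuousOn hpc)
        (continuousOn_const.mul hmc) hm0
    · intro x hx
      have := hpb x (hx0.trans hx)
      rw [norm_div, Complex.norm_real, Real.norm_of_nonneg (hpl.le.trans this.1)]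
      exact div_le_div₀ ((hpl.le.trans this.1).trans this.2) this.2 (by positivity) (hm2 x hx)
  have dp : ∀ᵐ x, (0:ℝ) ≤ x → HasDerivAt (fun t => (p t : ℂ)) (p' x : ℂ) x := by
    refine ae_deriv_of_rep (fun b hb => ii_ofReal (ii_of_Ioi hPQ.p'_int hb)) fun x hx => ?_
    rw [hPQ.p_ac x hx, intervalIntegral.integral_ofReal]; push_cast; rfl
  have dq : ∀ᵐ x, x₀ ≤ x → HasDerivAt (fun t => (q t : ℂ)) (q' x : ℂ) x := by
    refine ae_deriv_of_rep (fun b hb => ii_ofReal (ii_of_Ioi hPQ.q'_int hb)) fun x hx => ?_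
    rw [hPQ.q_ac x hx, intervalIntegral.integral_ofReal]; push_cast; rfl
  refine (i1.add i2).congr ?_
  rw [EventuallyEq, ae_restrict_iff' measurableSet_Ioi]
  filter_upwards [dp, dq, hr] with x h1 h2 h3 hx
  have hx' : x₁ ≤ x := le_of_lt hx
  have h1 := h1 (hx0.trans hx')
  have h2 := h2 (hx₁.trans hx')
  have h3 := h3 hx'
  have hP := h1.mul (h2.sub_const z)
  have hmm := h3.mul h3
  have heq : (fun t => m t * m t) =ᶠ[𝓝 x] fun t => (p t : ℂ) * ((q t : ℂ) - z) := by
    filter_upwards [lt_mem_nhds hx] with t ht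
    exact m_sq q z (hPQ.p_pos t (hx0.trans ht.le))
  have hu := hmm.unique (hP.congr_of_eventuallyEq heq)
  have := hm0 x hx'
  have hm0' : m x ≠ 0 := fun h0 => this (by rw [h0, mul_zero])
  simp only [Pi.add_apply]
  field_simp
  change r x * m x + m x * r x = _ at hu
  linear_combination -hu

lemma omg_int {p p' q q' : ℝ → ℝ} {p₀ x₀ : ℝ} (hPQ : PQData p p' q q' p₀ x₀) (z : ℂ)
    {x₁ pl pu : ℝ} (hx₁ : x₀ ≤ x₁) (hpl : 0 < pl)
    (hpb : ∀ x, 0 ≤ x → pl ≤ p x ∧ p x ≤ pu) :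
    IntervalIntegrable (omg p q z) volume 0 x₁ := by
  have hx0 : 0 ≤ x₁ := hPQ.hx₀.trans hx₁
  have hpc : ContinuousOn p (Ici 0) := cont_of_ac (ac_of_rep hPQ.p'_int hPQ.p_ac)
  have hqc : ContinuousOn q (Ici x₀) := cont_of_ac (ac_of_rep hPQ.q'_int hPQ.q_ac)
  have hqi : IntegrableOn q (Ioc 0 x₁) := by
    have h1 : IntegrableOn q (Icc x₀ x₁) :=
      (hqc.mono Icc_subset_Ici_self).integrableOn_Icc
    refine (hPQ.q_int.union h1).mono_set fun x hx => ?_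
    rcases lt_or_ge x x₀ with h | h
    · exact Or.inl ⟨hx.1, h⟩
    · exact Or.inr ⟨h, hx.2⟩
  rw [intervalIntegrable_iff_integrableOn_Ioc_of_le hx0]
  have hg : IntegrableOn (fun x => (|q x| + ‖z‖) / pl + 1) (Ioc 0 x₁) := by
    have hfin : IntegrableOn (fun _ : ℝ => ‖z‖) (Ioc 0 x₁) := integrableOn_const (by simp)
    have hfin1 : IntegrableOn (fun _ : ℝ => (1:ℝ)) (Ioc 0 x₁) := integrableOn_const (by simp)
    exact ((hqi.abs.add hfin).div_const pl).add hfin1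
  refine Integrable.mono' hg ?_ ?_
  · have hpm : AEMeasurable p (volume.restrict (Ioc 0 x₁)) :=
      (hpc.mono (fun x hx => le_of_lt hx.1)).aemeasurable measurableSet_Ioc
    have hqm : AEMeasurable q (volume.restrict (Ioc 0 x₁)) := hqi.aestronglyMeasurable.aemeasurable
    have : AEMeasurable (omg p q z) (volume.restrict (Ioc 0 x₁)) := by
      unfold omg
      exact (((Complex.measurable_ofReal.comp_aemeasurable hqm).sub_const z).div
        (Complex.measurable_ofReal.comp_aemeasurable hpm)).pow_const _
    exact this.aestronglyMeasurable
  · rw [ae_restrict_iff' measurableSet_Ioc]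
    refine Eventually.of_forall fun x hx => ?_
    have hp := hpb x hx.1.le
    have h1 : ‖omg p q z x‖ ^ 2 ≤ (|q x| + ‖z‖) / pl := by
      rw [← norm_pow, omg_sq, norm_div, Complex.norm_real, Real.norm_of_nonneg (hpl.le.trans hp.1)]
      refine div_le_div₀ (by positivity) ?_ hpl hp.1
      refine (norm_sub_le _ _).trans ?_
      rw [Complex.norm_real, Real.norm_eq_abs]
    nlinarith [norm_nonneg (omg p q z x)]

lemma m_tendsto {p p' q q' : ℝ → ℝ} {p₀ x₀ : ℝ} (hPQ : PQData p p' q q' p₀ x₀) {z : ℂ}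
    (hz : z.im ≠ 0) :
    ∃ l : ℂ, Tendsto (fun x => (p x : ℂ) * omg p q z x) atTop (𝓝 l) := by
  have hp : Tendsto (fun x => (p x : ℂ)) atTop (𝓝 (p₀ : ℂ)) :=
    (Complex.continuous_ofReal.tendsto _).comp hPQ.p_lim
  have hq : Tendsto (fun x => (q x : ℂ)) atTop (𝓝 ((0 : ℝ) : ℂ)) :=
    (Complex.continuous_ofReal.tendsto _).comp hPQ.q_lim
  have hp0 : (p₀ : ℂ) ≠ 0 := by exact_mod_cast hPQ.hp₀.ne'
  have h1 := (hq.sub_const z).div hp hp0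
  refine ⟨_, hp.mul (h1.cpow tendsto_const_nhds ?_)⟩
  right
  rw [Complex.div_ofReal_im]
  simp [hz, hPQ.hp₀.ne']

lemma G_bound {p : ℝ → ℝ} {om Om : ℝ → ℂ} {x δ : ℝ} (hδ : 0 < δ)
    (hp : ∀ y, x ≤ y → 0 < p y)
    (hpc : ContinuousOn p (Ici x))
    (hre : ∀ y, x ≤ y → δ ≤ ((p y : ℂ) * om y).re)
    (hOm : ∀ y ∈ Ici x, HasDerivWithinAt Om (om y) (Ici x) y) (y : ℝ) (hy : x ≤ y) :
    ‖Complex.exp (-Om y) ^ 2 * ∫ s in x..y, ((p s : ℂ))⁻¹ * (Complex.exp (-Om s) ^ 2)⁻¹‖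
      ≤ 1 / (2 * δ) := by
  have hOmc : ContinuousOn Om (Ici x) := fun t ht => (hOm t ht).continuousWithinAt
  have hc : ContinuousOn (fun s => ((p s : ℂ))⁻¹ * (Complex.exp (-Om s) ^ 2)⁻¹) (Ici x) := by
    refine ContinuousOn.mul ?_ ?_
    · refine ContinuousOn.inv₀ (Complex.continuous_ofReal.comp_continuousOn hpc) fun t ht => ?_
      exact_mod_cast (hp t ht).ne'
    · refine ContinuousOn.inv₀ ((Complex.continuous_exp.comp_continuousOn hOmc.neg).pow 2)
        fun t ht => pow_ne_zero _ (Complex.exp_ne_zero _)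
  have hH := hasDerivWithinAt_integral_Ici hc
  have hn : ∀ t, ‖(Complex.exp (-Om t) ^ 2)⁻¹‖ = Real.exp (2 * (Om t).re) := by
    intro t
    rw [norm_inv, norm_pow, Complex.norm_exp, ← Real.exp_nat_mul, ← Real.exp_neg]
    congr 1
    simp
  have hBd : ∀ t ∈ Ici x, HasDerivWithinAt (fun t => Real.exp (2 * (Om t).re) / (2 * δ))
      (Real.exp (2 * (Om t).re) * (2 * (om t).re) / (2 * δ)) (Ici x) t := by
    intro t ht
    have h1 : HasDerivWithinAt (fun t => (Om t).re) (om t).re (Ici x) t :=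
      Complex.reCLM.hasFDerivAt.comp_hasDerivWithinAt t (hOm t ht)
    exact ((h1.const_mul 2).exp).div_const _
  have hsub : Icc x y ⊆ Ici x := Icc_subset_Ici_self
  have key := image_norm_le_of_norm_deriv_right_le_deriv_boundary'
    (a := x) (b := y)
    (f := fun y => ∫ s in x..y, ((p s : ℂ))⁻¹ * (Complex.exp (-Om s) ^ 2)⁻¹)
    (fun t ht => ((hH t (hsub ht)).continuousWithinAt).mono hsub)
    (fun t ht => (hH t ht.1).mono (Ici_subset_Ici.2 ht.1))
    (B := fun t => Real.exp (2 * (Om t).re) / (2 * δ))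
    (B' := fun t => Real.exp (2 * (Om t).re) * (2 * (om t).re) / (2 * δ))
    (by simp; positivity)
    (fun t ht => ((hBd t (hsub ht)).continuousWithinAt).mono hsub)
    (fun t ht => (hBd t ht.1).mono (Ici_subset_Ici.2 ht.1))
    (by
      intro t ht
      have hpt := hp t ht.1
      rw [norm_mul, hn, norm_inv, Complex.norm_real, Real.norm_of_nonneg hpt.le]
      have h := hre t ht.1
      rw [Complex.re_ofReal_mul] at h
      rw [le_div_iff₀ (by positivity), inv_mul_eq_div, div_mul_eq_mul_div, div_le_iff₀ hpt]
      have := mul_le_mul_of_nonneg_left h (Real.exp_pos (2 * (Om t).re)).le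
      linarith)
    (right_mem_Icc.2 hy)
  rw [norm_mul]
  have e : ‖Complex.exp (-Om y) ^ 2‖ = (Real.exp (2 * (Om y).re))⁻¹ := by
    rw [← hn y, norm_inv, inv_inv]
  rw [e]
  calc _ ≤ (Real.exp (2 * (Om y).re))⁻¹ * (Real.exp (2 * (Om y).re) / (2 * δ)) :=
        mul_le_mul_of_nonneg_left key (by positivity)
    _ = 1 / (2 * δ) := by
        have := (Real.exp_pos (2 * (Om y).re)).ne'
        field_simp

/-- for `Im z ≠ 0`, a bounded solution `u` of
`(pu')' − 2ωpu' = r·u` on `[x₁,∞)` with `u(x) → 1` as `x → ∞`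
satisfies the Volterra integral equation `u(x) = 1 + ∫ₓ^∞ G(x,y,z) r(y) u(y) dy`. -/
theorem statement4 (p p' q q' : ℝ → ℝ) (p₀ x₀ : ℝ)
    (hPQ : PQData p p' q q' p₀ x₀)
    (z : ℂ) (hz : z.im ≠ 0)
    (x₁ : ℝ) (hx₁ : x₀ ≤ x₁) (hx₁q : ∀ x : ℝ, x₁ ≤ x → |q x| ≤ ‖z‖ / 2)
    (r : ℝ → ℂ)
    (hr : ∀ᵐ x ∂(volume : Measure ℝ), x₁ ≤ x →
      HasDerivAt (fun t => (p t : ℂ) * omg p q z t) (r x) x)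
    (u u' v : ℝ → ℂ)
    (hbdd : ∃ M : ℝ, ∀ x : ℝ, x₁ ≤ x → ‖u x‖ ≤ M)
    (hu : ∀ x ∈ Ici x₁, HasDerivWithinAt u (u' x) (Ici x₁) x)
    (hpu' : ∀ x ∈ Ici x₁, ∀ y ∈ Ici x₁,
      (p y : ℂ) * u' y - (p x : ℂ) * u' x = ∫ t in x..y, v t)
    (hode : ∀ᵐ x ∂(volume : Measure ℝ), x₁ ≤ x →
      v x - 2 * omg p q z x * (p x : ℂ) * u' x = r x * u x)
    (hlim : Tendsto u atTop (nhds 1)) :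
    ∀ x : ℝ, x₁ ≤ x → u x = 1 + ∫ y in Ioi x, Gker p q z x y * r y * u y := by
  intro x hx
  have hx0 : 0 ≤ x₁ := hPQ.hx₀.trans hx₁
  obtain ⟨pl, pu, hpl, hpb⟩ := p_bounds hPQ
  obtain ⟨δ, hδ, hm⟩ := m_lower hz hpl (fun x hx => hpb x (hx0.trans hx)) hx₁q
  have hmac := m_ac hPQ hx₁ hδ hm
  have hri := r_int hPQ hx₁ hδ hpl hpb hx₁q hm hr
  have hpp : ∀ y, x₁ ≤ y → 0 < p y := fun y hy => hPQ.p_pos y (hx0.trans hy)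
  have hpp0 : ∀ y, x₁ ≤ y → (p y : ℂ) ≠ 0 := fun y hy => by exact_mod_cast (hpp y hy).ne'
  have hpc : ContinuousOn p (Ici x₁) :=
    (cont_of_ac (ac_of_rep hPQ.p'_int hPQ.p_ac)).mono (Ici_subset_Ici.2 hx0)
  have hpcC : ContinuousOn (fun y => (p y : ℂ)) (Ici x₁) :=
    Complex.continuous_ofReal.comp_continuousOn hpc
  have hmc := cont_of_ac hmac
  have hoc : ContinuousOn (omg p q z) (Ici x₁) := by
    refine (hmc.div hpcC hpp0).congr fun y hy => ?_
    exact (mul_div_cancel_left₀ _ (hpp0 y hy)).symm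
  have huc : ContinuousOn u (Ici x₁) := fun y hy => (hu y hy).continuousWithinAt
  obtain ⟨M, hM⟩ := hbdd
  have hrui : IntegrableOn (fun y => u y * r y) (Ioi x₁) := bdd_cont_integrable hri huc hM
  -- local integrability of `v`
  have hvi : ∀ b, x₁ ≤ b → IntegrableOn v (Icc x₁ b) := by
    refine v_int (w := fun y => (p y : ℂ) * u' y) (α := fun y => 2 * omg p q z y)
      (β := fun y => u y * r y) hpu' ?_ (continuousOn_const.mul hoc) ?_
    · filter_upwards [hode] with y hy h1
      linear_combination hy h1
    · intro b hb
      rw [integrableOn_Icc_iff_integrableOn_Ioc]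
      exact hrui.mono_set Ioc_subset_Ioi_self
  have hvii : ∀ b, x₁ ≤ b → IntervalIntegrable v volume x₁ b := fun b hb =>
    (intervalIntegrable_iff_integrableOn_Icc_of_le hb).2 (hvi b hb)
  set w : ℝ → ℂ := fun y => (p y : ℂ) * u' y with hw
  have hwrep : ∀ y, x₁ ≤ y → w y = w x₁ + ∫ t in x₁..y, v t := fun y hy => by
    rw [← hpu' x₁ self_mem_Ici y hy]; simp only [hw]; ring
  have hwac : ∀ b, x₁ ≤ b → AbsolutelyContinuousOnInterval w x₁ b := fun b hb => by
    refine ac_congr ((ac_const (w x₁) x₁ b).add (ac_integral (hvii b hb))) fun y hy => ?_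
    rw [uIcc_of_le hb] at hy
    exact hwrep y hy.1
  have hwd : ∀ᵐ y, x₁ ≤ y → HasDerivAt w (v y) y := ae_deriv_of_rep hvii hwrep
  have hwc := cont_of_ac hwac
  have hu'c : ContinuousOn u' (Ici x₁) := by
    refine (hwc.div hpcC hpp0).congr fun y hy => ?_
    exact (mul_div_cancel_left₀ _ (hpp0 y hy)).symm
  have huac : ∀ b, x₁ ≤ b → AbsolutelyContinuousOnInterval u x₁ b := fun b hb =>
    ac_of_C1 hb (fun y hy => (hu y hy.1).mono Icc_subset_Ici_self) (hu'c.mono Icc_subset_Ici_self)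
  have hne : ∀ᵐ y : ℝ, y ≠ x₁ := by simp [ae_iff, measure_singleton]
  have hud : ∀ᵐ y, x₁ ≤ y → HasDerivAt u (u' y) y := by
    filter_upwards [hne] with y hy h1
    exact (hu y h1).hasDerivAt (Ici_mem_nhds (lt_of_le_of_ne h1 (Ne.symm hy)))
  -- `w` tends to zero
  have hwlim : Tendsto w atTop (𝓝 0) := by
    have hD : ∀ b, x₁ ≤ b → ∫ t in x₁..b, -(u t * r t) =
        (w b - 2 * (((p b : ℂ) * omg p q z b) * u b))
          - (w x₁ - 2 * (((p x₁ : ℂ) * omg p q z x₁) * u x₁)) := by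
      intro b hb
      refine (ac_ftc (f := fun b => w b - 2 * (((p b : ℂ) * omg p q z b) * u b))
        ((hwac b hb).sub (ac_mul (ac_const 2 x₁ b) (ac_mul (hmac b hb) (huac b hb)))) ?_).2
      filter_upwards [hwd, hud, hr, hode] with y h1 h2 h3 h4 hy
      rw [uIcc_of_le hb] at hy
      have h5 := (h1 hy.1).sub (((h3 hy.1).mul (h2 hy.1)).const_mul 2)
      refine h5.congr_deriv ?_
      linear_combination h4 hy.1
    obtain ⟨l, hl⟩ := m_tendsto hPQ hz
    have hI := intervalIntegral_tendsto_integral_Ioi x₁ hrui.neg tendsto_id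
    have h6 := ((hI.add_const (w x₁ - 2 * (((p x₁ : ℂ) * omg p q z x₁) * u x₁))).add
      ((hl.mul hlim).const_mul 2))
    obtain ⟨W, hW⟩ : ∃ W, Tendsto w atTop (𝓝 W) := by
      refine ⟨_, h6.congr' ?_⟩
      filter_upwards [eventually_ge_atTop x₁] with b hb
      have := hD b hb
      simp only [id, Pi.neg_apply]
      rw [this]
      ring
    have hpl' : Tendsto (fun x => (p x : ℂ)) atTop (𝓝 (p₀ : ℂ)) :=
      (Complex.continuous_ofReal.tendsto _).comp hPQ.p_lim
    have hp0 : (p₀ : ℂ) ≠ 0 := by exact_mod_cast hPQ.hp₀.ne'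
    have hu'l : Tendsto u' atTop (𝓝 (W / p₀)) := by
      refine (hW.div hpl' hp0).congr' ?_
      filter_upwards [eventually_ge_atTop x₁] with b hb
      have := hpp0 b hb
      simp only [hw, Pi.div_apply]
      field_simp
    have h0 := deriv_lim_zero hu hlim hu'l
    rw [div_eq_zero_iff] at h0
    rw [h0.resolve_right hp0] at hW
    exact hW
  -- the kernel
  have hsub : Ici x ⊆ Ici x₁ := Ici_subset_Ici.2 hx
  have hOm : ∀ y ∈ Ici x, HasDerivWithinAt (Omg p q z) (omg p q z y) (Ici x) y := by
    intro y hy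
    have h1 := (hasDerivWithinAt_integral_Ici hoc y (hsub hy)).const_add (Omg p q z x₁)
    have heq : ∀ t ∈ Ici x₁, Omg p q z t = Omg p q z x₁ + ∫ s in x₁..t, omg p q z s := by
      intro t ht
      have h2 : IntervalIntegrable (omg p q z) volume x₁ t := by
        refine ContinuousOn.intervalIntegrable (hoc.mono ?_)
        rw [uIcc_of_le ht]
        exact Icc_subset_Ici_self
      exact (intervalIntegral.integral_add_adjacent_intervals
        (omg_int hPQ z hx₁ hpl hpb) h2).symm
    exact (h1.congr heq (heq y (hsub hy))).mono hsub
  set G : ℝ → ℂ := Gker p q z x with hG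
  have hGb : ∀ y, x ≤ y → ‖G y‖ ≤ 1 / (2 * δ) :=
    G_bound hδ (fun y hy => hpp y (hx.trans hy)) (hpc.mono hsub)
      (fun y hy => hm y (hx.trans hy)) hOm
  have hOmc : ContinuousOn (Omg p q z) (Ici x) := fun t ht => (hOm t ht).continuousWithinAt
  have haa0 : ∀ t, aa p q z t ^ 2 ≠ 0 := fun t => pow_ne_zero _ (Complex.exp_ne_zero _)
  have hac : ContinuousOn (fun t => aa p q z t ^ 2) (Ici x) :=
    (Complex.continuous_exp.comp_continuousOn hOmc.neg).pow 2
  have hc : ContinuousOn (fun s => ((p s : ℂ))⁻¹ * (aa p q z s ^ 2)⁻¹) (Ici x) :=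
    ((hpcC.mono hsub).inv₀ fun t ht => hpp0 t (hsub ht)).mul (hac.inv₀ fun t _ => haa0 t)
  have hGd : ∀ y ∈ Ici x,
      HasDerivWithinAt G ((p y : ℂ)⁻¹ - 2 * omg p q z y * G y) (Ici x) y := by
    intro y hy
    have h1 := hasDerivWithinAt_integral_Ici hc y hy
    have h2 : HasDerivWithinAt (fun t => aa p q z t ^ 2)
        ((2 : ℕ) * aa p q z y ^ (2 - 1) * (aa p q z y * (-omg p q z y))) (Ici x) y :=
      ((hOm y hy).neg.cexp).pow 2
    refine (h2.mul h1).congr_deriv ?_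
    have h3 := haa0 y
    have h4 := hpp0 y (hsub hy)
    simp only [hG, Gker]
    have h5 : aa p q z y ^ 2 * ((p y : ℂ)⁻¹ * (aa p q z y ^ 2)⁻¹) = (p y : ℂ)⁻¹ := by
      rw [mul_left_comm, mul_inv_cancel₀ h3, mul_one]
    rw [h5]
    push_cast
    ring
  have hGc : ContinuousOn G (Ici x) := fun y hy => (hGd y hy).continuousWithinAt
  have hGx : G x = 0 := by simp [hG, Gker]
  have hGac : ∀ b, x ≤ b → AbsolutelyContinuousOnInterval G x b := fun b hb =>
    ac_of_C1 hb (fun y hy => (hGd y hy.1).mono Icc_subset_Ici_self)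
      (((((hpcC.mono hsub).inv₀ fun t ht => hpp0 t (hsub ht))).sub
        ((continuousOn_const.mul (hoc.mono hsub)).mul hGc)).mono Icc_subset_Ici_self)
  have hGi : IntegrableOn (fun y => G y * (u y * r y)) (Ioi x) :=
    bdd_cont_integrable (hrui.mono_set (Ioi_subset_Ioi hx)) hGc hGb
  have hnex : ∀ᵐ y : ℝ, y ≠ x := by simp [ae_iff, measure_singleton]
  have hF : ∀ b, x ≤ b → ∫ t in x..b, G t * (u t * r t) = (G b * w b - u b) - (G x * w x - u x) := by
    intro b hb
    have hss : uIcc x b ⊆ uIcc x₁ b := by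
      rw [uIcc_of_le hb, uIcc_of_le (hx.trans hb)]; exact Icc_subset_Icc_left hx
    refine (ac_ftc (f := fun b => G b * w b - u b)
      ((ac_mul (hGac b hb) ((hwac b (hx.trans hb)).mono hss)).sub
        ((huac b (hx.trans hb)).mono hss)) ?_).2
    filter_upwards [hwd, hud, hode, hnex] with y h1 h2 h4 h5 hy
    rw [uIcc_of_le hb] at hy
    have hy1 : x₁ ≤ y := hx.trans hy.1
    have h6 := (hGd y hy.1).hasDerivAt (Ici_mem_nhds (lt_of_le_of_ne hy.1 (Ne.symm h5)))
    refine ((h6.mul (h1 hy1)).sub (h2 hy1)).congr_deriv ?_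
    have h7 : (p y : ℂ)⁻¹ * w y = u' y := by
      simp only [hw]
      rw [← mul_assoc, inv_mul_cancel₀ (hpp0 y hy1), one_mul]
    have h8 := h4 hy1
    have h9 : w y = (p y : ℂ) * u' y := rfl
    linear_combination h7 + G y * h8 - 2 * omg p q z y * G y * h9
  have hlim1 := intervalIntegral_tendsto_integral_Ioi x hGi tendsto_id
  have hGw : Tendsto (fun b => G b * w b) atTop (𝓝 0) := by
    refine squeeze_zero_norm' (a := fun b => 1 / (2 * δ) * ‖w b‖) ?_ ?_
    · filter_upwards [eventually_ge_atTop x] with b hb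
      rw [norm_mul]
      exact mul_le_mul_of_nonneg_right (hGb b hb) (norm_nonneg _)
    · simpa using hwlim.norm.const_mul (1 / (2 * δ))
  have hlim2 := (hGw.sub hlim).sub_const (G x * w x - u x)
  have hfin := tendsto_nhds_unique (hlim1.congr' (by
    filter_upwards [eventually_ge_atTop x] with b hb using hF b hb)) hlim2
  rw [hGx] at hfin
  have hfin2 : ∫ y in Ioi x, G y * r y * u y = ∫ y in Ioi x, G y * (u y * r y) := by
    congr 1; ext y; ring
  rw [hfin2, hfin]
  ring

end
end

section
/- Let z ∈ ℂ \ [0,∞). Then the Volterra integral equation u(x) = 1 + ∫ₓ^∞ G(x,y,z) r(y,z) u(y) dy has a unique bounded continuous solution u : [x₁(z),∞) → ℂ, and there is a constant C such that |u(x) − 1| ≤ C ε(x) for all x ≥ x₁(z). -/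
open MeasureTheory Filter Set Complex

noncomputable section

lemma weight_ineq (g : ℝ → ℝ) (hg : Integrable g) (hg0 : ∀ x, 0 ≤ g x) :
    ∃ (W : ℝ → ℝ) (c M : ℝ), Continuous W ∧ 0 < c ∧ (∀ x, c ≤ W x) ∧ (∀ x, W x ≤ M) ∧
      ∀ x, ∫ y in Ioi x, g y * W y ≤ W x / 2 := by
  set P : ℝ → ℝ := fun y => ∫ t in (0:ℝ)..y, g t with hP
  have hPc : Continuous P := intervalIntegral.continuous_primitive (fun a b => hg.intervalIntegrable) 0
  have hPb : ∀ x, |P x| ≤ ∫ t, g t := by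
    intro x
    calc |P x| ≤ ∫ t in uIoc 0 x, |g t| := by
          have := intervalIntegral.norm_integral_le_integral_norm_uIoc (f := g) (a := 0) (b := x) (μ := volume)
          simpa using this
      _ ≤ ∫ t, |g t| := setIntegral_le_integral hg.abs (ae_of_all _ fun _ => abs_nonneg _)
      _ = ∫ t, g t := by simp [abs_of_nonneg, hg0]
  set I := ∫ t, g t
  have hWc : Continuous (fun y => Real.exp (-2 * P y)) := by fun_prop
  have hgWint : Integrable (fun y => g y * Real.exp (-2 * P y)) := by
    refine hg.mul_bdd (c := Real.exp (2 * I)) hWc.aestronglyMeasurable (ae_of_all _ fun x => ?_)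
    rw [Real.norm_eq_abs, Real.abs_exp]
    apply Real.exp_le_exp.2
    have := abs_le.1 (hPb x); linarith
  refine ⟨fun y => Real.exp (-2 * P y), Real.exp (-2 * I), Real.exp (2 * I), hWc,
    Real.exp_pos _, ?_, ?_, ?_⟩
  · intro x
    apply Real.exp_le_exp.2
    have := abs_le.1 (hPb x); linarith
  · intro x
    apply Real.exp_le_exp.2
    have := abs_le.1 (hPb x); linarith
  · intro x
    have hPmono : Monotone P := by
      intro a b hab
      have : P b - P a = ∫ t in a..b, g t :=
        intervalIntegral.integral_interval_sub_left hg.intervalIntegrable hg.intervalIntegrable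
      have h2 : 0 ≤ ∫ t in a..b, g t := intervalIntegral.integral_nonneg hab fun t _ => hg0 t
      linarith
    have hlim := intervalIntegral_tendsto_integral_Ioi x hgWint.integrableOn tendsto_id
    refine le_of_tendsto hlim ?_
    filter_upwards [eventually_ge_atTop x] with b hb
    simp only [id]
    set f : ℝ → ℝ := fun y => -(Real.exp (-2 * P y)) / 2 with hf
    have hfm : Monotone f := by
      intro a b hab
      have : Real.exp (-2 * P b) ≤ Real.exp (-2 * P a) :=
        Real.exp_le_exp.2 (by have := hPmono hab; linarith)
      simp only [hf]; linarith
    have hd : ∀ᵐ y, deriv f y = g y * Real.exp (-2 * P y) := by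
      filter_upwards [LocallyIntegrable.ae_hasDerivAt_integral hg.locallyIntegrable] with y hy
      have h1 := (((hy 0).const_mul (-2)).exp.neg).div_const 2
      have h2 : HasDerivAt f _ y := h1
      rw [h2.deriv]
      simp only [hP]
      ring
    have h := (hfm.monotoneOn (uIcc x b)).intervalIntegral_deriv_mem_uIcc
    rw [uIcc_of_le (by have := hfm hb; linarith)] at h
    have h2 : ∫ y in x..b, deriv f y = ∫ y in x..b, g y * Real.exp (-2 * P y) :=
      intervalIntegral.integral_congr_ae (hd.mono fun y hy _ => hy)
    rw [← h2]
    refine h.2.trans ?_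
    simp only [hf]
    have := Real.exp_pos (-2 * P b)
    linarith

lemma volterra (g : ℝ → ℝ) (hg : Integrable g) (hg0 : ∀ x, 0 ≤ g x) (k : ℝ → ℝ → ℂ)
    (hmeas : ∀ x, AEStronglyMeasurable (k x) volume)
    (hbd : ∀ x, ∀ᵐ y, ‖k x y‖ ≤ (Ioi x).indicator g y)
    (hcont : ∀ᵐ y, Continuous (fun x => k x y)) :
    ∃ u : ℝ → ℂ, (Continuous u ∧ (∃ M : ℝ, ∀ x, ‖u x‖ ≤ M) ∧ ∀ x, u x = 1 + ∫ y, k x y * u y) ∧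
      (∃ C : ℝ, 0 ≤ C ∧ ∀ x, ‖u x - 1‖ ≤ C * ∫ y in Ioi x, g y) ∧
      ∀ w : ℝ → ℂ, (Continuous w ∧ (∃ M : ℝ, ∀ x, ‖w x‖ ≤ M) ∧ ∀ x, w x = 1 + ∫ y, k x y * w y) →
        ∀ x, w x = u x := by
  obtain ⟨W, c, M, hWc, hc, hcW, hWM, hW⟩ := weight_ineq g hg hg0
  have hWpos : ∀ x, 0 < W x := fun x => hc.trans_le (hcW x)
  have hMpos : 0 < M := (hWpos 0).trans_le (hWM 0)
  have hbd' : ∀ x, ∀ᵐ y, ‖k x y‖ ≤ g y := fun x => (hbd x).mono fun y hy =>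
    hy.trans (indicator_le_self' (fun _ _ => hg0 _) y)
  -- continuity of the integral operator
  have hTc : ∀ v : ℝ → ℂ, Continuous v → (∃ B : ℝ, ∀ x, ‖v x‖ ≤ B) →
      Continuous (fun x => ∫ y, k x y * v y) := by
    rintro v hv ⟨B, hB⟩
    refine continuous_of_dominated (bound := fun y => g y * B) ?_ ?_ (hg.mul_const B) ?_
    · intro x; exact (hmeas x).mul hv.aestronglyMeasurable
    · intro x
      filter_upwards [hbd' x] with y hy
      rw [norm_mul]
      exact mul_le_mul hy (hB y) (norm_nonneg _) (hg0 y)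
    · filter_upwards [hcont] with y hy
      exact hy.mul continuous_const
  have hTi : ∀ x (v : ℝ → ℂ), Continuous v → (∃ B : ℝ, ∀ x, ‖v x‖ ≤ B) →
      Integrable (fun y => k x y * v y) := by
    rintro x v hv ⟨B, hB⟩
    refine (hg.mul_const B).mono' ((hmeas x).mul hv.aestronglyMeasurable) ?_
    filter_upwards [hbd' x] with y hy
    rw [norm_mul]
    exact mul_le_mul hy (hB y) (norm_nonneg _) (hg0 y)
  -- weighted bound
  have hTb : ∀ x (v : ℝ → ℂ) (B : ℝ), (∀ y, ‖v y‖ ≤ B * W y) →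
      ‖∫ y, k x y * v y‖ ≤ B * (W x / 2) := by
    intro x v B hB
    have hB0 : 0 ≤ B := by
      have := (norm_nonneg _).trans (hB 0)
      exact nonneg_of_mul_nonneg_left this (hWpos 0)
    have hgW : Integrable (fun y => g y * W y) := by
      refine hg.mul_bdd (c := M) hWc.aestronglyMeasurable (ae_of_all _ fun x => ?_)
      rw [Real.norm_eq_abs, abs_of_pos (hWpos x)]; exact hWM x
    calc ‖∫ y, k x y * v y‖ ≤ ∫ y, (Ioi x).indicator (fun y => B * (g y * W y)) y := by
          refine norm_integral_le_of_norm_le ((hgW.const_mul B).indicator measurableSet_Ioi) ?_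
          filter_upwards [hbd x] with y hy
          rw [norm_mul]
          by_cases h : y ∈ Ioi x
          · simp only [h, indicator_of_mem] at hy ⊢
            calc _ ≤ g y * (B * W y) := mul_le_mul hy (hB y) (norm_nonneg _) (hg0 y)
              _ = _ := by ring
          · simp only [h, indicator_of_notMem, not_false_eq_true] at hy ⊢
            have : ‖k x y‖ = 0 := le_antisymm hy (norm_nonneg _)
            simp [this]
      _ = B * ∫ y in Ioi x, g y * W y := by
          rw [integral_indicator measurableSet_Ioi, integral_const_mul]
      _ ≤ _ := mul_le_mul_of_nonneg_left (hW x) hB0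
  have hTb1 : ∀ x (v : ℝ → ℂ) (B : ℝ), (∀ y, ‖v y‖ ≤ B) →
      ‖∫ y, k x y * v y‖ ≤ B * ∫ y in Ioi x, g y := by
    intro x v B hB
    calc ‖∫ y, k x y * v y‖ ≤ ∫ y, (Ioi x).indicator (fun y => B * g y) y := by
          refine norm_integral_le_of_norm_le ((hg.const_mul B).indicator measurableSet_Ioi) ?_
          filter_upwards [hbd x] with y hy
          rw [norm_mul]
          by_cases h : y ∈ Ioi x
          · simp only [h, indicator_of_mem] at hy ⊢
            calc _ ≤ g y * B := mul_le_mul hy (hB y) (norm_nonneg _) (hg0 y)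
              _ = _ := by ring
          · simp only [h, indicator_of_notMem, not_false_eq_true] at hy ⊢
            have : ‖k x y‖ = 0 := le_antisymm hy (norm_nonneg _)
            simp [this]
      _ = B * ∫ y in Ioi x, g y := by
          rw [integral_indicator measurableSet_Ioi, integral_const_mul]
  have hWC : ∀ x, (W x : ℂ) ≠ 0 := fun x => by exact_mod_cast (hWpos x).ne'
  have hWCc : Continuous (fun x => (W x : ℂ)) := Complex.continuous_ofReal.comp hWc
  -- unweighting
  let U : BoundedContinuousFunction ℝ ℂ → ℝ → ℂ := fun v y => (W y : ℂ) * v y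
  have hUc : ∀ v, Continuous (U v) := fun v => hWCc.mul v.continuous
  have hUW : ∀ v y, ‖U v y‖ ≤ ‖v‖ * W y := by
    intro v y
    simp only [U, norm_mul, Complex.norm_real, Real.norm_eq_abs, abs_of_pos (hWpos y)]
    rw [mul_comm]
    exact mul_le_mul_of_nonneg_right (v.norm_coe_le_norm y) (hWpos y).le
  have hUb : ∀ v, ∃ B : ℝ, ∀ y, ‖U v y‖ ≤ B := fun v =>
    ⟨‖v‖ * M, fun y => (hUW v y).trans (mul_le_mul_of_nonneg_left (hWM y) (norm_nonneg _))⟩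
  have hnW : ∀ x, ‖(W x : ℂ)⁻¹‖ = (W x)⁻¹ := fun x => by
    rw [norm_inv, Complex.norm_real, Real.norm_eq_abs, abs_of_pos (hWpos x)]
  let T : BoundedContinuousFunction ℝ ℂ → BoundedContinuousFunction ℝ ℂ := fun v =>
    BoundedContinuousFunction.ofNormedAddCommGroup
      (fun x => (W x : ℂ)⁻¹ * (1 + ∫ y, k x y * U v y))
      ((hWCc.inv₀ hWC).mul (continuous_const.add (hTc _ (hUc v) (hUb v))))
      (c⁻¹ + ‖v‖ / 2) (by
        intro x
        rw [norm_mul, hnW]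
        have h1 := hTb x (U v) ‖v‖ (hUW v)
        have h2 : ‖1 + ∫ y, k x y * U v y‖ ≤ 1 + ‖v‖ * (W x / 2) :=
          (norm_add_le _ _).trans (by rw [norm_one]; linarith)
        calc (W x)⁻¹ * ‖1 + ∫ y, k x y * U v y‖ ≤ (W x)⁻¹ * (1 + ‖v‖ * (W x / 2)) :=
              mul_le_mul_of_nonneg_left h2 (inv_nonneg.2 (hWpos x).le)
          _ = (W x)⁻¹ + ‖v‖ / 2 := by have := (hWpos x).ne'; field_simp
          _ ≤ _ := by have := inv_anti₀ hc (hcW x); linarith)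
  have hTapp : ∀ v x, T v x = (W x : ℂ)⁻¹ * (1 + ∫ y, k x y * U v y) := fun v x => rfl
  have hcontr : ContractingWith (1/2 : NNReal) T := by
    refine ⟨by
      rw [← NNReal.coe_lt_coe]; norm_num, LipschitzWith.of_dist_le_mul fun v w => ?_⟩
    rw [BoundedContinuousFunction.dist_le (by positivity)]
    intro x
    rw [hTapp, hTapp, dist_eq_norm, dist_eq_norm, ← mul_sub, add_sub_add_left_eq_sub,
      ← integral_sub (hTi x _ (hUc v) (hUb v)) (hTi x _ (hUc w) (hUb w))]
    have : (fun y => k x y * U v y - k x y * U w y) = fun y => k x y * U (v - w) y := by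
      funext y; simp only [U, BoundedContinuousFunction.coe_sub, Pi.sub_apply]; ring
    rw [this, norm_mul, hnW]
    have h1 := hTb x _ _ (hUW (v - w))
    calc _ ≤ (W x)⁻¹ * (‖v - w‖ * (W x / 2)) :=
              mul_le_mul_of_nonneg_left h1 (inv_nonneg.2 (hWpos x).le)
      _ = 1 / 2 * ‖v - w‖ := by have := (hWpos x).ne'; field_simp
      _ = _ := by norm_num
  have hfix := hcontr.fixedPoint_isFixedPt
  set v := ContractingWith.fixedPoint T hcontr
  have hsol : ∀ x, U v x = 1 + ∫ y, k x y * U v y := by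
    intro x
    have h1 : T v x = v x := by rw [hfix]
    rw [hTapp] at h1
    have h2 : U v x = W x * v x := rfl
    rw [h2, ← h1, mul_inv_cancel_left₀ (hWC x)]
  refine ⟨U v, ⟨hUc v, hUb v, hsol⟩, ?_, ?_⟩
  · obtain ⟨B, hB⟩ := hUb v
    refine ⟨B, (norm_nonneg _).trans (hB 0), fun x => ?_⟩
    have : U v x - 1 = ∫ y, k x y * U v y := by
      have := hsol x
      linear_combination this
    rw [this]
    exact hTb1 x _ B hB
  · rintro w ⟨hwc, ⟨B, hB⟩, hw⟩ x
    let w' : BoundedContinuousFunction ℝ ℂ := BoundedContinuousFunction.ofNormedAddCommGroup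
      (fun x => (W x : ℂ)⁻¹ * w x) ((hWCc.inv₀ hWC).mul hwc) (c⁻¹ * B) (by
        intro x
        rw [norm_mul, hnW]
        exact mul_le_mul (inv_anti₀ hc (hcW x)) (hB x) (norm_nonneg _) (inv_nonneg.2 hc.le))
    have hUw : U w' = w := by
      funext y
      change (W y : ℂ) * ((W y : ℂ)⁻¹ * w y) = w y
      rw [mul_inv_cancel_left₀ (hWC y)]
    have : Function.IsFixedPt T w' := by
      ext y
      rw [hTapp, hUw, ← hw]
      rfl
    have h := hcontr.fixedPoint_unique this
    rw [← hUw, h]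

lemma ac_facts (f f' : ℝ → ℝ) (a : ℝ) (h : ∀ x, a ≤ x → f x = f a + ∫ t in a..x, f' t)
    (hi : IntegrableOn f' (Ioi a)) :
    ContinuousOn f (Ici a) ∧ ∀ᵐ x, a < x → HasDerivAt f (f' x) x := by
  have hI : Integrable ((Ioi a).indicator f') := hi.integrable_indicator measurableSet_Ioi
  have h' : ∀ x, a ≤ x → f x = f a + ∫ t in a..x, (Ioi a).indicator f' t := by
    intro x hx
    rw [h x hx]
    congr 1
    refine intervalIntegral.integral_congr_ae (ae_of_all _ fun t ht => ?_)
    rw [uIoc_of_le hx] at ht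
    rw [indicator_of_mem (show t ∈ Ioi a from ht.1)]
  constructor
  · refine ContinuousOn.congr (f := fun x => f a + ∫ t in a..x, (Ioi a).indicator f' t) ?_
      (fun x hx => h' x hx)
    exact (continuous_const.add (intervalIntegral.continuous_primitive
      (fun _ _ => hI.intervalIntegrable) a)).continuousOn
  · filter_upwards [LocallyIntegrable.ae_hasDerivAt_integral hI.locallyIntegrable] with x hx hax
    have h1 := (hx a).const_add (f a)
    rw [indicator_of_mem (show x ∈ Ioi a from hax)] at h1
    refine h1.congr_of_eventuallyEq ?_
    filter_upwards [Ioi_mem_nhds hax] with y hy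
    exact h' y (le_of_lt hy)

lemma p_bounds_s6 (p : ℝ → ℝ) (p₀ : ℝ) (hp₀ : 0 < p₀) (hpos : ∀ x, 0 ≤ x → 0 < p x)
    (hc : ContinuousOn p (Ici 0)) (hlim : Tendsto p atTop (nhds p₀)) :
    ∃ m M : ℝ, 0 < m ∧ ∀ x, 0 ≤ x → m ≤ p x ∧ p x ≤ M := by
  have h1 : ∀ᶠ x in atTop, p₀ / 2 < p x ∧ p x < 2 * p₀ :=
    (hlim.eventually (lt_mem_nhds (by linarith))).and (hlim.eventually (gt_mem_nhds (by linarith)))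
  obtain ⟨N, hN⟩ := eventually_atTop.1 h1
  have hcp : IsCompact (Icc 0 (max N 0)) := isCompact_Icc
  have hne : (Icc 0 (max N 0)).Nonempty := ⟨0, by simp⟩
  have hc' : ContinuousOn p (Icc 0 (max N 0)) := hc.mono fun x hx => hx.1
  obtain ⟨a, ha, hamin⟩ := hcp.exists_isMinOn hne hc'
  obtain ⟨b, hb, hbmax⟩ := hcp.exists_isMaxOn hne hc'
  refine ⟨min (p a) (p₀ / 2), max (p b) (2 * p₀), lt_min (hpos a ha.1) (by linarith), fun x hx => ?_⟩
  by_cases hxN : x ≤ max N 0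
  · exact ⟨(min_le_left _ _).trans (hamin ⟨hx, hxN⟩), (hbmax ⟨hx, hxN⟩).trans (le_max_left _ _)⟩
  · have := hN x ((le_max_left _ _).trans (not_le.1 hxN).le)
    exact ⟨(min_le_right _ _).trans this.1.le, this.2.le.trans (le_max_right _ _)⟩

lemma re_sqrt_pos {w : ℂ} (hw : w ∈ slitPlane) : 0 < (w ^ (1 / 2 : ℂ)).re := by
  have hne := slitPlane_ne_zero hw
  rw [cpow_def_of_ne_zero hne, exp_re]
  refine mul_pos (Real.exp_pos _) (Real.cos_pos_of_mem_Ioo ?_)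
  have him : (log w * (1 / 2)).im = w.arg / 2 := by
    simp [mul_im, log_im]
    ring
  rw [him]
  have h1 := neg_pi_lt_arg w
  have h2 := (arg_le_pi w).lt_of_ne (mem_slitPlane_iff_arg.1 hw).1
  constructor <;> linarith

lemma sqrt_sq (w : ℂ) : (w ^ (1 / 2 : ℂ)) ^ 2 = w := by
  have := Complex.cpow_nat_inv_pow w (n := 2) (by norm_num)
  rw [one_div]
  exact_mod_cast this

lemma mem_slit {z : ℂ} (hz : ∀ t : ℝ, 0 ≤ t → (t : ℂ) ≠ z) {a b : ℝ} (ha : |a| ≤ ‖z‖ / 2)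
    (hb : 0 < b) : ((a : ℂ) - z) / (b : ℂ) ∈ slitPlane := by
  rw [mem_slitPlane_iff, div_ofReal_re, div_ofReal_im]
  by_cases him : z.im = 0
  · left
    have hzr : z = (z.re : ℂ) := by apply Complex.ext <;> simp [him]
    have hneg : z.re < 0 := by
      by_contra h
      exact hz z.re (not_lt.1 h) hzr.symm
    have hn : ‖z‖ = -z.re := by
      rw [hzr, Complex.norm_real, Real.norm_eq_abs, abs_of_neg hneg, ofReal_re]
    have := (abs_le.1 ha).1
    apply div_pos _ hb
    simp
    linarith
  · right
    simp
    exact ⟨him, hb.ne'⟩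

lemma re_lower {z : ℂ} (hz : ∀ t : ℝ, 0 ≤ t → (t : ℂ) ≠ z) {m M : ℝ} (hm : 0 < m) :
    ∃ c : ℝ, 0 < c ∧ ∀ a b : ℝ, |a| ≤ ‖z‖ / 2 → m ≤ b → b ≤ M →
      c ≤ ((((a : ℂ) - z) / (b : ℂ)) ^ (1 / 2 : ℂ)).re := by
  by_cases hne : m ≤ M
  swap
  · exact ⟨1, one_pos, fun a b _ h1 h2 => absurd (h1.trans h2) hne⟩
  have hcp : IsCompact (Icc (-(‖z‖ / 2)) (‖z‖ / 2) ×ˢ Icc m M) := isCompact_Icc.prod isCompact_Icc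
  have hc : ContinuousOn (fun w : ℝ × ℝ => ((((w.1 : ℂ) - z) / (w.2 : ℂ)) ^ (1 / 2 : ℂ)).re)
      (Icc (-(‖z‖ / 2)) (‖z‖ / 2) ×ˢ Icc m M) := by
    refine continuous_re.comp_continuousOn (ContinuousOn.cpow_const ?_ ?_)
    · refine ContinuousOn.div (by fun_prop) (by fun_prop) ?_
      rintro ⟨a, b⟩ ⟨_, hb⟩
      have : b ≠ 0 := (hm.trans_le hb.1).ne'
      exact_mod_cast this
    · rintro ⟨a, b⟩ ⟨ha, hb⟩
      exact mem_slit hz (abs_le.2 ha) (hm.trans_le hb.1)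
  obtain ⟨⟨a, b⟩, ⟨ha, hb⟩, hmin⟩ := hcp.exists_isMinOn
    ⟨(0, m), by simp [hne]; positivity⟩ hc
  refine ⟨_, re_sqrt_pos (mem_slit hz (abs_le.2 ha) (hm.trans_le hb.1)), fun a' b' h1 h2 h3 => ?_⟩
  exact hmin (show (a', b') ∈ _ from ⟨abs_le.1 h1, h2, h3⟩)

lemma omg_integrable (p q : ℝ → ℝ) (z : ℂ) (x₀ m : ℝ) (hx₀ : 0 ≤ x₀) (hm : 0 < m)
    (hpc : ContinuousOn p (Ici 0)) (hpm : ∀ x, 0 ≤ x → m ≤ p x)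
    (hqi : IntegrableOn q (Ioo 0 x₀)) (hqc : ContinuousOn q (Ici x₀)) (b : ℝ) :
    IntegrableOn (omg p q z) (Ioc 0 b) := by
  have hq : IntegrableOn q (Ioc 0 b) := by
    have h1 : IntegrableOn q (Ioc 0 x₀) := (integrableOn_Ioc_iff_integrableOn_Ioo).2 hqi
    have h2 : IntegrableOn q (Icc x₀ b) :=
      (hqc.mono fun x hx => hx.1).integrableOn_Icc
    refine (h1.union h2).mono_set fun x hx => ?_
    by_cases h : x ≤ x₀
    · exact Or.inl ⟨hx.1, h⟩
    · exact Or.inr ⟨(not_le.1 h).le, hx.2⟩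
  have hpmeas : AEMeasurable p (volume.restrict (Ioc 0 b)) :=
    (hpc.mono fun x hx => le_of_lt hx.1).aemeasurable measurableSet_Ioc
  have hwm : AEMeasurable (fun x => ((q x : ℂ) - z) / (p x : ℂ)) (volume.restrict (Ioc 0 b)) :=
    ((measurable_ofReal.comp_aemeasurable hq.aemeasurable).sub_const z).div
      (measurable_ofReal.comp_aemeasurable hpmeas)
  have hbound : IntegrableOn (fun x => 1 + (|q x| + ‖z‖) / m) (Ioc 0 b) := by
    have hk : ∀ k : ℝ, IntegrableOn (fun _ => k) (Ioc 0 b) := fun k =>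
      integrableOn_const (by simp)
    exact (hk 1).add ((hq.abs.add (hk ‖z‖)).div_const m)
  refine Integrable.mono' hbound (hwm.pow_const _).aestronglyMeasurable ?_
  rw [ae_restrict_iff' measurableSet_Ioc]
  refine ae_of_all _ fun x hx => ?_
  have hp := hpm x hx.1.le
  have h1 : ‖(((q x : ℂ) - z) / (p x : ℂ)) ^ (1 / 2 : ℂ)‖ ^ 2 = ‖((q x : ℂ) - z) / (p x : ℂ)‖ := by
    rw [← norm_pow, sqrt_sq]
  have h2 : ‖((q x : ℂ) - z) / (p x : ℂ)‖ ≤ (|q x| + ‖z‖) / m := by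
    rw [norm_div, Complex.norm_real, Real.norm_eq_abs, abs_of_pos (hm.trans_le hp)]
    refine div_le_div₀ (by positivity) ?_ hm hp
    refine (norm_sub_le _ _).trans ?_
    rw [Complex.norm_real, Real.norm_eq_abs]
  change ‖(((q x : ℂ) - z) / (p x : ℂ)) ^ (1 / 2 : ℂ)‖ ≤ _
  nlinarith [sq_nonneg (‖(((q x : ℂ) - z) / (p x : ℂ)) ^ (1 / 2 : ℂ)‖ - 1),
    norm_nonneg ((((q x : ℂ) - z) / (p x : ℂ)) ^ (1 / 2 : ℂ))]

/-- Everything about the kernel. -/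
lemma ker_facts (p q : ℝ → ℝ) (z : ℂ) (x₁ m c : ℝ) (hx₁ : 0 ≤ x₁) (hm : 0 < m) (hc : 0 < c)
    (hpc : ContinuousOn p (Ici 0)) (hpm : ∀ x, 0 ≤ x → m ≤ p x)
    (hoi : ∀ b, IntegrableOn (omg p q z) (Ioc 0 b))
    (hre : ∀ x, x₁ ≤ x → c ≤ (omg p q z x).re) :
    ContinuousOn (aa p q z) (Ici x₁) ∧
    ContinuousOn (fun s => ((p s : ℂ))⁻¹ * (aa p q z s ^ 2)⁻¹) (Ici x₁) ∧
    ∀ x y, x₁ ≤ x → x ≤ y → ‖Gker p q z x y‖ ≤ m⁻¹ * (2 * c)⁻¹ := by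
  have hii : ∀ a b, 0 ≤ a → 0 ≤ b → IntervalIntegrable (omg p q z) volume a b := by
    have h0 : ∀ b, 0 ≤ b → IntervalIntegrable (omg p q z) volume 0 b := fun b hb =>
      (intervalIntegrable_iff_integrableOn_Ioc_of_le hb).2 (hoi b)
    exact fun a b ha hb => (h0 a ha).symm.trans (h0 b hb)
  have hOc : ContinuousOn (Omg p q z) (Ici 0) := by
    intro x hx
    have hx' : (0:ℝ) ≤ x := hx
    have h1 : ContinuousOn (Omg p q z) (uIcc 0 (x + 1)) :=
      intervalIntegral.continuousOn_primitive_interval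
        (by
          rw [uIcc_of_le (by linarith), integrableOn_Icc_iff_integrableOn_Ioc]
          exact hoi _)
    have h2 := h1 x (by rw [uIcc_of_le (by linarith)]; exact ⟨hx', by linarith⟩)
    refine h2.mono_of_mem_nhdsWithin ?_
    rw [uIcc_of_le (by linarith)]
    exact mem_nhdsWithin.2 ⟨Iio (x + 1), isOpen_Iio, by simp, fun y hy => ⟨hy.2, le_of_lt hy.1⟩⟩
  have hac : ContinuousOn (aa p q z) (Ici x₁) :=
    (continuous_exp.comp_continuousOn hOc.neg).mono (Ici_subset_Ici.2 hx₁)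
  have hane : ∀ s, aa p q z s ^ 2 ≠ 0 := fun s => pow_ne_zero _ (exp_ne_zero _)
  have hphi : ContinuousOn (fun s => ((p s : ℂ))⁻¹ * (aa p q z s ^ 2)⁻¹) (Ici x₁) := by
    refine ContinuousOn.mul (ContinuousOn.inv₀ ?_ ?_) ((hac.pow 2).inv₀ fun s _ => hane s)
    · exact continuous_ofReal.comp_continuousOn (hpc.mono (Ici_subset_Ici.2 hx₁))
    · intro x hx
      have : p x ≠ 0 := (hm.trans_le (hpm x (hx₁.trans hx))).ne'
      exact_mod_cast this
  refine ⟨hac, hphi, fun x y hx hxy => ?_⟩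
  have key : ∀ s, x ≤ s → s ≤ y → ‖aa p q z y ^ 2 * (((p s : ℂ))⁻¹ * (aa p q z s ^ 2)⁻¹)‖ ≤
      m⁻¹ * Real.exp (-(2 * c) * (y - s)) := by
    intro s hs hsy
    have hs0 : 0 ≤ s := by linarith
    have hps := hpm s hs0
    have hre' : c * (y - s) ≤ (Omg p q z y - Omg p q z s).re := by
      have h1 : Omg p q z y - Omg p q z s = ∫ t in s..y, omg p q z t :=
        intervalIntegral.integral_interval_sub_left (hii _ _ le_rfl (by linarith)) (hii _ _ le_rfl hs0)
      have hi := hii s y hs0 (by linarith)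
      have h2 : (∫ t in s..y, omg p q z t).re = ∫ t in s..y, (omg p q z t).re := by
        have := Complex.reCLM.intervalIntegral_comp_comm hi
        simpa using this.symm
      have h3 : ∫ t in s..y, c ≤ ∫ t in s..y, (omg p q z t).re := by
        refine intervalIntegral.integral_mono_on hsy (by simp) ?_ ?_
        · exact ⟨hi.1.re, hi.2.re⟩
        · intro t ht; exact hre t (by linarith [ht.1])
      rw [h1, h2]
      simp at h3
      linarith
    have h4 : aa p q z y ^ 2 * (((p s : ℂ))⁻¹ * (aa p q z s ^ 2)⁻¹) =
        ((p s : ℂ))⁻¹ * Complex.exp (-2 * (Omg p q z y - Omg p q z s)) := by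
      unfold aa
      rw [← Complex.exp_nat_mul, ← Complex.exp_nat_mul, ← Complex.exp_neg, mul_left_comm,
        ← Complex.exp_add]
      congr 2
      push_cast; ring
    rw [h4, norm_mul, norm_inv, Complex.norm_real, Real.norm_eq_abs, abs_of_pos (hm.trans_le hps),
      Complex.norm_exp]
    refine mul_le_mul (inv_anti₀ hm hps) (Real.exp_le_exp.2 ?_) (Real.exp_pos _).le (by positivity)
    have : (-2 * (Omg p q z y - Omg p q z s)).re = -2 * (Omg p q z y - Omg p q z s).re := by
      simp [mul_re]
    rw [this]
    linarith
  have h5 : ∫ s in x..y, m⁻¹ * Real.exp (-(2 * c) * (y - s)) ≤ m⁻¹ * (2 * c)⁻¹ := by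
    have hd : ∀ s ∈ uIcc x y, HasDerivAt (fun s => m⁻¹ * ((2 * c)⁻¹ * Real.exp (-(2 * c) * (y - s))))
        (m⁻¹ * Real.exp (-(2 * c) * (y - s))) s := by
      intro s _
      have h1 := ((((((hasDerivAt_id s).const_sub y).const_mul (-(2 * c))).exp).const_mul
        ((2 * c)⁻¹)).const_mul m⁻¹)
      refine h1.congr_deriv ?_
      simp only [id]
      field_simp
    rw [intervalIntegral.integral_eq_sub_of_hasDerivAt hd
      (Continuous.intervalIntegrable (by fun_prop) _ _)]
    simp only [sub_self, mul_zero, Real.exp_zero, mul_one]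
    have : 0 ≤ m⁻¹ * ((2 * c)⁻¹ * Real.exp (-(2 * c) * (y - x))) := by positivity
    linarith
  unfold Gker
  rw [← intervalIntegral.integral_const_mul]
  refine le_trans (intervalIntegral.norm_integral_le_of_norm_le hxy (ae_of_all _ fun s hs => ?_)
    (Continuous.intervalIntegrable (by fun_prop) _ _)) h5
  exact key s hs.1.le hs.2

/-- the Volterra integral equation `u(x) = 1 + ∫ₓ^∞ G(x,y,z) r(y) u(y) dy`
has a unique bounded continuous solution `u` on `[x₁(z),∞)`, and `|u(x) − 1| ≤ C ε(x)`. -/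
theorem statement6 (p p' q q' : ℝ → ℝ) (p₀ x₀ : ℝ)
    (hPQ : PQData p p' q q' p₀ x₀)
    (z : ℂ) (hz : ∀ t : ℝ, 0 ≤ t → (t : ℂ) ≠ z)
    (x₁ : ℝ) (hx₁ : x₀ ≤ x₁) (hx₁q : ∀ x : ℝ, x₁ ≤ x → |q x| ≤ ‖z‖ / 2)
    (r : ℝ → ℂ)
    (hr : ∀ᵐ x ∂(volume : Measure ℝ), x₁ ≤ x →
      HasDerivAt (fun t => (p t : ℂ) * omg p q z t) (r x) x) :
    ∃ u : ℝ → ℂ,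
      (ContinuousOn u (Ici x₁) ∧ (∃ M : ℝ, ∀ x : ℝ, x₁ ≤ x → ‖u x‖ ≤ M) ∧
        ∀ x : ℝ, x₁ ≤ x → u x = 1 + ∫ y in Ioi x, Gker p q z x y * r y * u y) ∧
      (∃ C : ℝ, ∀ x : ℝ, x₁ ≤ x → ‖u x - 1‖ ≤ C * eps p' q' x) ∧
      ∀ w : ℝ → ℂ,
        (ContinuousOn w (Ici x₁) ∧ (∃ M : ℝ, ∀ x : ℝ, x₁ ≤ x → ‖w x‖ ≤ M) ∧
          ∀ x : ℝ, x₁ ≤ x → w x = 1 + ∫ y in Ioi x, Gker p q z x y * r y * w y) →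
        ∀ x : ℝ, x₁ ≤ x → w x = u x := by
  have hx10 : 0 ≤ x₁ := hPQ.hx₀.trans hx₁
  obtain ⟨hpc, hpd⟩ := ac_facts p p' 0 hPQ.p_ac hPQ.p'_int
  obtain ⟨hqc, hqd⟩ := ac_facts q q' x₀ hPQ.q_ac hPQ.q'_int
  obtain ⟨m, Mp, hm, hpb⟩ := p_bounds_s6 p p₀ hPQ.hp₀ hPQ.p_pos hpc hPQ.p_lim
  obtain ⟨c, hc, hcb⟩ := re_lower hz (m := m) (M := Mp) hm
  have hre : ∀ x, x₁ ≤ x → c ≤ (omg p q z x).re := fun x hx =>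
    hcb _ _ (hx₁q x hx) (hpb x (hx10.trans hx)).1 (hpb x (hx10.trans hx)).2
  have hpm : ∀ x, 0 ≤ x → m ≤ p x := fun x hx => (hpb x hx).1
  have hoi := omg_integrable p q z x₀ m hPQ.hx₀ hm hpc hpm hPQ.q_int hqc
  obtain ⟨hac, hphi, hG⟩ := ker_facts p q z x₁ m c hx10 hm hc hpc hpm hoi hre
  have hMp : 0 ≤ Mp := hm.le.trans ((hpb 0 le_rfl).1.trans (hpb 0 le_rfl).2)
  -- the formula for `r`
  have hF0 : ∀ x, x₁ ≤ x → m * c ≤ ‖(p x : ℂ) * omg p q z x‖ := by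
    intro x hx
    rw [norm_mul, Complex.norm_real, Real.norm_eq_abs,
      abs_of_pos (hm.trans_le (hpm x (hx10.trans hx)))]
    refine mul_le_mul (hpm x (hx10.trans hx)) ?_ hc.le (hm.le.trans (hpm x (hx10.trans hx)))
    exact (hre x hx).trans (Complex.re_le_norm _)
  have hrf : ∀ᵐ x, x₁ < x → r x =
      ((p' x : ℂ) * ((q x : ℂ) - z) + (p x : ℂ) * (q' x : ℂ)) / (2 * ((p x : ℂ) * omg p q z x)) := by
    filter_upwards [hr, hpd, hqd] with x hrx hpx hqx hx
    have h1 := (hrx hx.le).mul (hrx hx.le)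
    have h2 := (hpx (hx10.trans_lt hx)).ofReal_comp.mul
      (((hqx (hx₁.trans_lt hx)).ofReal_comp).sub_const z)
    have h3 := h2.congr_of_eventuallyEq (f₁ := (fun t => (p t : ℂ) * omg p q z t) *
        (fun t => (p t : ℂ) * omg p q z t)) (by
      filter_upwards [Ioi_mem_nhds (hx10.trans_lt hx)] with t ht
      have hpt : (p t : ℂ) ≠ 0 := by
        have : p t ≠ 0 := (hPQ.p_pos t (le_of_lt ht)).ne'
        exact_mod_cast this
      have h4 : omg p q z t ^ 2 = ((q t : ℂ) - z) / (p t : ℂ) := sqrt_sq _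
      simp only [Pi.mul_apply]
      calc _ = (p t : ℂ) ^ 2 * omg p q z t ^ 2 := by ring
        _ = _ := by rw [h4]; field_simp)
    have h5 := h1.unique h3
    have hne : (p x : ℂ) * omg p q z x ≠ 0 :=
      norm_pos_iff.1 ((mul_pos hm hc).trans_le (hF0 x hx.le))
    rw [eq_div_iff (mul_ne_zero two_ne_zero hne)]
    linear_combination h5
  have hp'i : IntegrableOn p' (Ioi x₁) := hPQ.p'_int.mono_set (Ioi_subset_Ioi hx10)
  have hq'i : IntegrableOn q' (Ioi x₁) := hPQ.q'_int.mono_set (Ioi_subset_Ioi hx₁)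
  have hpc1 : ContinuousOn p (Ici x₁) := hpc.mono (Ici_subset_Ici.2 hx10)
  have hqc1 : ContinuousOn q (Ici x₁) := hqc.mono (Ici_subset_Ici.2 hx₁)
  set C1 : ℝ := (3 / 2 * ‖z‖ + Mp) / (2 * (m * c)) with hC1
  have hC10 : 0 ≤ C1 := by positivity
  have hrb : ∀ᵐ x, x₁ < x → ‖r x‖ ≤ C1 * (|p' x| + |q' x|) := by
    filter_upwards [hrf] with x hx hxx
    rw [hx hxx, norm_div]
    have h1 : 2 * (m * c) ≤ ‖2 * ((p x : ℂ) * omg p q z x)‖ := by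
      rw [norm_mul]
      have := hF0 x hxx.le
      simp only [Complex.norm_ofNat]
      linarith
    have h2 : ‖(p' x : ℂ) * ((q x : ℂ) - z) + (p x : ℂ) * (q' x : ℂ)‖ ≤
        (3 / 2 * ‖z‖ + Mp) * (|p' x| + |q' x|) := by
      refine (norm_add_le _ _).trans ?_
      rw [norm_mul, norm_mul, Complex.norm_real, Complex.norm_real, Complex.norm_real]
      simp only [Real.norm_eq_abs]
      have h3 : ‖(q x : ℂ) - z‖ ≤ 3 / 2 * ‖z‖ := by
        refine (norm_sub_le _ _).trans ?_
        rw [Complex.norm_real, Real.norm_eq_abs]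
        linarith [hx₁q x hxx.le]
      have h4 : |p x| ≤ Mp := by
        rw [abs_of_pos (hPQ.p_pos x (hx10.trans hxx.le))]
        exact (hpb x (hx10.trans hxx.le)).2
      have h5 := mul_le_mul_of_nonneg_left h3 (abs_nonneg (p' x))
      have h6 := mul_le_mul_of_nonneg_right h4 (abs_nonneg (q' x))
      have h7 : 0 ≤ Mp * |p' x| := by positivity
      have h8 : 0 ≤ 3 / 2 * ‖z‖ * |q' x| := by positivity
      nlinarith
    calc _ ≤ ((3 / 2 * ‖z‖ + Mp) * (|p' x| + |q' x|)) / (2 * (m * c)) :=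
          div_le_div₀ (by positivity) h2 (by positivity) h1
      _ = _ := by rw [hC1]; ring
  have hrm : AEStronglyMeasurable r (volume.restrict (Ioi x₁)) := by
    have hmp : AEMeasurable p (volume.restrict (Ioi x₁)) :=
      (hpc1.mono Ioi_subset_Ici_self).aemeasurable measurableSet_Ioi
    have hmq : AEMeasurable q (volume.restrict (Ioi x₁)) :=
      (hqc1.mono Ioi_subset_Ici_self).aemeasurable measurableSet_Ioi
    have hmp' : AEMeasurable p' (volume.restrict (Ioi x₁)) := hp'i.aemeasurable
    have hmq' : AEMeasurable q' (volume.restrict (Ioi x₁)) := hq'i.aemeasurable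
    have cp := measurable_ofReal.comp_aemeasurable hmp
    have cq := measurable_ofReal.comp_aemeasurable hmq
    have cp' := measurable_ofReal.comp_aemeasurable hmp'
    have cq' := measurable_ofReal.comp_aemeasurable hmq'
    have co : AEMeasurable (omg p q z) (volume.restrict (Ioi x₁)) :=
      ((cq.sub_const z).div cp).pow_const _
    have := ((cp'.mul (cq.sub_const z)).add (cp.mul cq')).div ((cp.mul co).const_mul 2)
    refine this.aestronglyMeasurable.congr ?_
    rw [EventuallyEq, ae_restrict_iff' measurableSet_Ioi]
    filter_upwards [hrf] with x hx hxx
    rw [hx hxx]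
    rfl
  -- the kernel
  set K : ℝ := m⁻¹ * (2 * c)⁻¹ with hK
  have hK0 : 0 ≤ K := by positivity
  set g0 : ℝ → ℝ := fun y => K * C1 * (|p' y| + |q' y|) with hg0
  have hg0n : ∀ y, 0 ≤ g0 y := fun y => by simp only [hg0]; positivity
  have hgi : Integrable ((Ioi x₁).indicator g0) := by
    rw [integrable_indicator_iff measurableSet_Ioi]
    exact (hp'i.abs.add hq'i.abs).const_mul _
  set k : ℝ → ℝ → ℂ := fun x => (Ioi (max x x₁)).indicator
    (fun y => Gker p q z (max x x₁) y * r y) with hk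
  -- a globally continuous version of the integrand
  set φ : ℝ → ℂ := fun s => ((p (max s x₁) : ℂ))⁻¹ * (aa p q z (max s x₁) ^ 2)⁻¹ with hφ
  have hφc : Continuous φ := hphi.comp_continuous (f := fun s => max s x₁)
    (continuous_id.max continuous_const) (fun s => mem_Ici.2 (le_max_right s x₁))
  have hGφ : ∀ x y, x₁ ≤ x → x ≤ y → Gker p q z x y = aa p q z y ^ 2 * ∫ s in x..y, φ s := by
    intro x y hx hxy
    unfold Gker
    congr 1
    refine intervalIntegral.integral_congr fun s hs => ?_
    rw [uIcc_of_le hxy] at hs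
    simp only [hφ, max_eq_left (hx.trans hs.1)]
  have hkm : ∀ x, AEStronglyMeasurable (k x) volume := by
    intro x
    simp only [hk]
    rw [aestronglyMeasurable_indicator_iff measurableSet_Ioi]
    have hs : Ioi (max x x₁) ⊆ Ioi x₁ := Ioi_subset_Ioi (le_max_right _ _)
    refine AEStronglyMeasurable.mul ?_ (hrm.mono_set hs)
    have : ContinuousOn (fun y => aa p q z y ^ 2 * ∫ s in (max x x₁)..y, φ s)
        (Ioi (max x x₁)) :=
      ((hac.mono (hs.trans Ioi_subset_Ici_self)).pow 2).mul
        (intervalIntegral.continuous_primitive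
          (fun _ _ => hφc.intervalIntegrable _ _) _).continuousOn
    refine ContinuousOn.aestronglyMeasurable (this.congr fun y hy => ?_) measurableSet_Ioi
    exact hGφ _ _ (le_max_right _ _) (le_of_lt hy)
  have hkb : ∀ x, ∀ᵐ y, ‖k x y‖ ≤ (Ioi x).indicator ((Ioi x₁).indicator g0) y := by
    intro x
    filter_upwards [hrb] with y hy
    by_cases h : y ∈ Ioi (max x x₁)
    · have h1 : y ∈ Ioi x := (le_max_left x x₁).trans_lt h
      have h2 : y ∈ Ioi x₁ := (le_max_right x x₁).trans_lt h
      simp only [hk, indicator_of_mem h, indicator_of_mem h1, indicator_of_mem h2, norm_mul, hg0]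
      rw [mul_assoc]
      exact mul_le_mul (hG _ _ (le_max_right _ _) (le_of_lt h)) (hy h2) (norm_nonneg _) hK0
    · simp only [hk, indicator_of_notMem h, norm_zero]
      exact indicator_nonneg (fun _ _ => indicator_nonneg (fun _ _ => hg0n _) _) _
  have hkc : ∀ᵐ y, Continuous (fun x => k x y) := by
    refine ae_of_all _ fun y => ?_
    by_cases hy : x₁ ≤ y
    · have : (fun x => k x y) = fun x => aa p q z y ^ 2 *
          (∫ s in (min (max x x₁) y)..y, φ s) * r y := by
        funext x
        by_cases h : max x x₁ < y
        · have h' : y ∈ Ioi (max x x₁) := h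
          simp only [hk, indicator_of_mem h', min_eq_left h.le]
          rw [hGφ _ _ (le_max_right _ _) h.le]
        · have h' : y ∉ Ioi (max x x₁) := h
          simp only [hk, indicator_of_notMem h', min_eq_right (not_lt.1 h)]
          simp
      rw [this]
      have hc1 : Continuous (fun x => ∫ s in y..x, φ s) :=
        intervalIntegral.continuous_primitive (fun _ _ => hφc.intervalIntegrable _ _) _
      have hc2 : Continuous (fun x => ∫ s in (min (max x x₁) y)..y, φ s) := by
        have : (fun x => ∫ s in (min (max x x₁) y)..y, φ s) =
            fun x => -∫ s in y..(min (max x x₁) y), φ s := by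
          funext x; rw [intervalIntegral.integral_symm]
        rw [this]
        exact (hc1.comp (g := fun x => ∫ s in y..x, φ s)
          (f := fun x => min (max x x₁) y) (by fun_prop)).neg
      exact (continuous_const.mul hc2).mul continuous_const
    · have : (fun x => k x y) = fun _ => 0 := by
        funext x
        have h' : y ∉ Ioi (max x x₁) := fun h => hy ((le_max_right x x₁).trans (le_of_lt h))
        simp only [hk, indicator_of_notMem h']
      rw [this]
      exact continuous_const
  obtain ⟨u, ⟨huc, ⟨B, huB⟩, hu⟩, ⟨C, hC0, huC⟩, huniq⟩ := volterra _ hgi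
    (fun x => indicator_nonneg (fun _ _ => hg0n _) _) k hkm hkb hkc
  have hconv : ∀ x (v : ℝ → ℂ), ∫ y, k x y * v y =
      ∫ y in Ioi (max x x₁), Gker p q z (max x x₁) y * r y * v y := by
    intro x v
    rw [← integral_indicator measurableSet_Ioi]
    congr 1
    funext y
    by_cases h : y ∈ Ioi (max x x₁)
    · simp only [hk, indicator_of_mem h]
    · simp only [hk, indicator_of_notMem h, zero_mul]
  refine ⟨u, ⟨huc.continuousOn, ⟨B, fun x _ => huB x⟩, fun x hx => ?_⟩,
    ⟨C * (K * C1), fun x hx => ?_⟩, ?_⟩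
  · rw [hu x, hconv, max_eq_left hx]
  · refine (huC x).trans (le_of_eq ?_)
    rw [setIntegral_indicator measurableSet_Ioi,
      inter_eq_left.2 (Ioi_subset_Ioi hx : Ioi x ⊆ Ioi x₁)]
    simp only [hg0, eps]
    rw [integral_const_mul]
    ring
  · rintro w ⟨hwc, ⟨B', hwB⟩, hw⟩ x hx
    have := huniq (fun x => w (max x x₁)) ⟨hwc.comp_continuous
      (continuous_id.max continuous_const) (fun s => mem_Ici.2 (le_max_right s x₁)),
      ⟨B', fun x => hwB _ (le_max_right _ _)⟩, fun x => ?_⟩ x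
    · simpa [max_eq_left hx] using this
    · rw [hw _ (le_max_right _ _), hconv]
      congr 1
      refine setIntegral_congr_fun measurableSet_Ioi fun y hy => ?_
      have : x₁ ≤ y := (le_max_right x x₁).trans (le_of_lt hy)
      simp only [max_eq_left this]

end
end
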